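/- arXiv:1810.04224 — 7 statements merged into one kernel-verified Lean document; each statement's English description precedes it below -/
import Mathlib

section
/- Let N ≥ 2 be an integer and let f : ℝ → ℝ be differentiable with both f and its derivative f' Lebesgue integrable on ℝ. Then for every ε > 0, |∑_{n ∈ ℤ} ∫_{nε}^{nε + ε/N} f(x) dx − (1/N) ∫_ℝ f(x) dx| ≤ (ε/N) ∫_ℝ |f'(x)| dx. -/
open MeasureTheory

lemma abs_sub_le_integral_abs_deriv {f : ℝ → ℝ} (hdiff : Differentiable ℝ f)
    (hf' : Integrable (deriv f)) {a b x y : ℝ} (hax : a ≤ x) (hxy : x ≤ y) (hyb : y ≤ b) :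
    |f x - f y| ≤ ∫ t in a..b, |deriv f t| := by
  rw [abs_sub_comm, ← intervalIntegral.integral_deriv_eq_sub (fun t _ => hdiff t)
    hf'.intervalIntegrable]
  exact (intervalIntegral.abs_integral_le_integral_abs hxy).trans
    (intervalIntegral.integral_mono_interval hax hxy hyb
      (Filter.Eventually.of_forall fun t => abs_nonneg _) hf'.abs.intervalIntegrable)

/-- Compare the integral over the initial `1/N` part of an interval with `1/N` times the integral
over the whole interval. -/
lemma abs_integral_initial_part_sub_le {f : ℝ → ℝ} (hdiff : Differentiable ℝ f)
    (hf' : Integrable (deriv f)) {N : ℝ} (hN : 1 ≤ N) (a : ℝ) {ε : ℝ} (hε : 0 ≤ ε) :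
    |(∫ x in a..(a + ε / N), f x) - (1 / N) * ∫ x in a..(a + ε), f x|
      ≤ (ε / N) * ∫ x in a..(a + ε), |deriv f x| := by
  have hN0 : 0 < N := by linarith
  have h1 : (∫ x in a..(a + ε / N), f x) = (1 / N) * ∫ x in (0 : ℝ)..ε, f (a + x / N) := by
    rw [intervalIntegral.integral_comp_add_div f hN0.ne']
    simp [hN0.ne']
  have h2 : (∫ x in a..(a + ε), f x) = ∫ x in (0 : ℝ)..ε, f (a + x) := by
    simp [intervalIntegral.integral_comp_add_left f]
  have hc := hdiff.continuous
  rw [h1, h2, ← mul_sub, ← intervalIntegral.integral_sub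
    (Continuous.intervalIntegrable (by fun_prop) _ _)
    (Continuous.intervalIntegrable (by fun_prop) _ _), abs_mul, abs_of_pos (by positivity)]
  have h3 := intervalIntegral.norm_integral_le_of_norm_le_const (a := 0) (b := ε)
    (f := fun x => f (a + x / N) - f (a + x)) (C := ∫ x in a..(a + ε), |deriv f x|) ?_
  · rw [Real.norm_eq_abs, sub_zero, abs_of_nonneg hε] at h3
    calc _ ≤ (1 / N) * ((∫ x in a..(a + ε), |deriv f x|) * ε) := by gcongr
      _ = _ := by ring
  · intro x hx
    rw [Set.uIoc_of_le hε] at hx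
    have hx0 : 0 ≤ x / N := div_nonneg hx.1.le hN0.le
    have hx1 : x / N ≤ x := div_le_self hx.1.le hN
    exact abs_sub_le_integral_abs_deriv hdiff hf' (by linarith) (by linarith) (by linarith [hx.2])

lemma pairwise_disjoint_Ioc_intCast_mul (ε : ℝ) :
    Pairwise (Function.onFun Disjoint fun n : ℤ => Set.Ioc ((n : ℝ) * ε) ((n : ℝ) * ε + ε)) := by
  simpa [add_mul] using Set.pairwise_disjoint_Ioc_zsmul ε

lemma hasSum_integral_intCast_mul {g : ℝ → ℝ} (hg : Integrable g) {ε : ℝ} (hε : 0 < ε) :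
    HasSum (fun n : ℤ => ∫ x in ((n : ℝ) * ε)..((n : ℝ) * ε + ε), g x) (∫ x, g x) := by
  have hU : ⋃ n : ℤ, Set.Ioc ((n : ℝ) * ε) ((n : ℝ) * ε + ε) = Set.univ := by
    simpa [add_mul] using iUnion_Ioc_zsmul hε
  have h := hasSum_integral_iUnion (fun _ => measurableSet_Ioc)
    (pairwise_disjoint_Ioc_intCast_mul ε) hg.integrableOn
  rw [hU, setIntegral_univ] at h
  simpa only [intervalIntegral.integral_of_le (le_add_of_nonneg_right hε.le)] using h

lemma summable_integral_intCast_mul {g : ℝ → ℝ} (hg : Integrable g) {δ ε : ℝ} (hδ : 0 ≤ δ)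
    (hδε : δ ≤ ε) :
    Summable fun n : ℤ => ∫ x in ((n : ℝ) * ε)..((n : ℝ) * ε + δ), g x := by
  have h := hasSum_integral_iUnion
    (s := fun n : ℤ => Set.Ioc ((n : ℝ) * ε) ((n : ℝ) * ε + δ)) (fun _ => measurableSet_Ioc)
    (fun m n hmn => (pairwise_disjoint_Ioc_intCast_mul ε hmn).mono
      (Set.Ioc_subset_Ioc_right (by gcongr)) (Set.Ioc_subset_Ioc_right (by gcongr)))
    hg.integrableOn
  simpa only [intervalIntegral.integral_of_le (le_add_of_nonneg_right hδ)] using h.summable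

/-- Sampling a `W^{1,1}` function: for an integer `N ≥ 2` and a differentiable function
`f : ℝ → ℝ` with `f` and `f'` integrable, for every `ε > 0`,
`|∑_{n ∈ ℤ} ∫_{nε}^{nε + ε/N} f - (1/N) ∫_ℝ f| ≤ (ε/N) ∫_ℝ |f'|`. -/
theorem sampling_W11 (N : ℕ) (hN : 2 ≤ N) (f : ℝ → ℝ)
    (hdiff : Differentiable ℝ f) (hf : Integrable f) (hf' : Integrable (deriv f))
    (ε : ℝ) (hε : 0 < ε) :
    |(∑' n : ℤ, ∫ x in ((n : ℝ) * ε)..((n : ℝ) * ε + ε / N), f x)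
        - (1 / N) * ∫ x, f x| ≤ (ε / N) * ∫ x, |deriv f x| := by
  have hN1 : (1 : ℝ) ≤ N := by exact_mod_cast (by lia : 1 ≤ N)
  have hs := (summable_integral_intCast_mul hf (δ := ε / N) (by positivity)
    (div_le_self hε.le hN1)).hasSum
  have hd := hs.sub ((hasSum_integral_intCast_mul hf hε).mul_left (1 / (N : ℝ)))
  rw [← hd.tsum_eq, ← Real.norm_eq_abs]
  exact tsum_of_norm_bounded ((hasSum_integral_intCast_mul hf'.abs hε).mul_left (ε / N))
    fun n => abs_integral_initial_part_sub_le hdiff hf' hN1 _ hε.le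
end

section
/- Let p > 1, ω ∈ ℝ, and let φ : ℝ → ℝ be four times continuously differentiable, with constants C > 0 and κ > 0 such that |φ^{(k)}(x)| ≤ C e^{−κ|x|} for all x ∈ ℝ and all k = 0,1,2,3,4. Suppose φ satisfies the profile equation φ''''(x) + ω φ''(x) + φ(x) + p |φ'(x)|^{p−1} φ''(x) = 0 for all x ∈ ℝ (i.e. φ'''' + ωφ'' + φ + ∂_x(|φ'|^{p−1}φ') = 0). Then the following Pohozaev identities hold: ∫_ℝ φ''(x)² dx = ∫_ℝ φ(x)² dx + ((p−1)/(2(p+1))) ∫_ℝ |φ'(x)|^{p+1} dx, and ω ∫_ℝ φ'(x)² dx = 2 ∫_ℝ φ(x)² dx − ((p+3)/(2(p+1))) ∫_ℝ |φ'(x)|^{p+1} dx. -/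
open MeasureTheory

open Filter Topology

/-- The signed power `y ↦ |y|^r y` is differentiable everywhere for `r > 0`. -/
theorem hasDerivAt_abs_rpow_mul_self {r : ℝ} (hr : 0 < r) (y : ℝ) :
    HasDerivAt (fun y : ℝ => |y| ^ r * y) ((r + 1) * |y| ^ r) y := by
  rcases eq_or_ne y 0 with rfl | hy
  · rw [hasDerivAt_iff_tendsto_slope_zero]
    have h : Tendsto (fun t : ℝ => |t| ^ r) (𝓝[≠] 0) (𝓝 (|0| ^ r)) :=
      ((continuous_abs.rpow_const fun _ => Or.inr hr.le).tendsto 0).mono_left nhdsWithin_le_nhds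
    simp only [abs_zero, Real.zero_rpow hr.ne', mul_zero] at h ⊢
    refine h.congr' ?_
    filter_upwards [self_mem_nhdsWithin] with t ht
    have ht : t ≠ 0 := ht
    simp only [zero_add, sub_zero, smul_eq_mul]
    field_simp
  · have hpos : 0 < |y| := abs_pos.mpr hy
    have h := ((hasDerivAt_abs hy).rpow_const (p := r) (Or.inl hpos.ne')).mul (hasDerivAt_id y)
    refine h.congr_deriv ?_
    have h1 : |y| ^ r = |y| ^ (r - 1) * |y| := by
      rw [← Real.rpow_add_one hpos.ne', sub_add_cancel]
    have h2 : (SignType.sign y : ℝ) * y = |y| := sign_mul_self y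
    simp only [id]
    linear_combination r * |y| ^ (r - 1) * h2 - r * h1

theorem integrable_exp_neg_mul_abs {κ : ℝ} (hκ : 0 < κ) :
    Integrable fun x : ℝ => Real.exp (-κ * |x|) := by
  rw [← integrableOn_univ, ← Set.Iic_union_Ioi (a := (0 : ℝ))]
  refine IntegrableOn.union ?_ ?_
  · refine (integrableOn_exp_mul_Iic hκ 0).congr_fun (fun x hx => ?_) measurableSet_Iic
    simp [abs_of_nonpos (Set.mem_Iic.mp hx)]
  · refine (integrableOn_exp_mul_Ioi (neg_lt_zero.mpr hκ) 0).congr_fun (fun x hx => ?_)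
      measurableSet_Ioi
    simp [abs_of_pos (Set.mem_Ioi.mp hx)]

theorem tendsto_cocompact_zero_of_abs_le_exp {f : ℝ → ℝ} {C κ : ℝ} (hκ : 0 < κ)
    (hf : ∀ x, |f x| ≤ C * Real.exp (-κ * |x|)) : Tendsto f (cocompact ℝ) (𝓝 0) := by
  refine squeeze_zero_norm hf ?_
  have h := (tendsto_rpow_mul_exp_neg_mul_atTop_nhds_zero 0 κ hκ).comp
    (tendsto_norm_cocompact_atTop (E := ℝ))
  simpa using h.const_mul C

theorem tendsto_cocompact_zero_of_abs_le_exp_mul {f : ℝ → ℝ} {C κ : ℝ} (hκ : 0 < κ)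
    (hf : ∀ x, |f x| ≤ C * Real.exp (-κ * |x|)) :
    Tendsto (fun x => x * f x) (cocompact ℝ) (𝓝 0) := by
  have h := (tendsto_rpow_mul_exp_neg_mul_atTop_nhds_zero 1 κ hκ).comp
    (tendsto_norm_cocompact_atTop (E := ℝ))
  have h' : Tendsto (fun x : ℝ => C * (|x| * Real.exp (-κ * |x|))) (cocompact ℝ) (𝓝 0) := by
    simpa using h.const_mul C
  refine squeeze_zero_norm (fun x => ?_) h'
  rw [Real.norm_eq_abs, abs_mul]
  calc |x| * |f x| ≤ |x| * (C * Real.exp (-κ * |x|)) := by gcongr; exact hf x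
    _ = _ := by ring

theorem integrable_mul_of_abs_le_exp {f g : ℝ → ℝ} {C D κ : ℝ} (hκ : 0 < κ)
    (hfc : Continuous f) (hgc : Continuous g)
    (hf : ∀ x, |f x| ≤ C * Real.exp (-κ * |x|)) (hg : ∀ x, |g x| ≤ D) :
    Integrable fun x => f x * g x := by
  refine ((integrable_exp_neg_mul_abs hκ).const_mul (C * D)).mono'
    (hfc.mul hgc).aestronglyMeasurable (Eventually.of_forall fun x => ?_)
  rw [Real.norm_eq_abs, abs_mul]
  calc |f x| * |g x| ≤ (C * Real.exp (-κ * |x|)) * D :=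
        mul_le_mul (hf x) (hg x) (abs_nonneg _) ((abs_nonneg _).trans (hf x))
    _ = _ := by ring

theorem integral_eq_zero_of_hasDerivAt_of_tendsto_cocompact {F F' : ℝ → ℝ}
    (hF : ∀ x, HasDerivAt F (F' x) x) (hF' : Integrable F')
    (h0 : Tendsto F (cocompact ℝ) (𝓝 0)) : ∫ x, F' x = 0 := by
  simpa using integral_of_hasDerivAt_of_tendsto hF hF' (h0.mono_left atBot_le_cocompact)
    (h0.mono_left atTop_le_cocompact)

/-- Pohozaev identities for solutions of `φ'''' + ωφ'' + φ + ∂_x(|φ'|^{p-1}φ') = 0`. -/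
theorem pohozaev_identities_signed_nonlinearity (p ω : ℝ) (hp : 1 < p)
    (φ : ℝ → ℝ) (hφ : ContDiff ℝ 4 φ) (C κ : ℝ) (hC : 0 < C) (hκ : 0 < κ)
    (hdecay : ∀ k ≤ 4, ∀ x : ℝ, |iteratedDeriv k φ x| ≤ C * Real.exp (-κ * |x|))
    (heq : ∀ x : ℝ, iteratedDeriv 4 φ x + ω * iteratedDeriv 2 φ x + φ x
      + p * |deriv φ x| ^ (p - 1) * iteratedDeriv 2 φ x = 0) :
    (∫ x : ℝ, (iteratedDeriv 2 φ x) ^ 2)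
      = (∫ x : ℝ, (φ x) ^ 2)
        + ((p - 1) / (2 * (p + 1))) * ∫ x : ℝ, |deriv φ x| ^ (p + 1) ∧
    ω * (∫ x : ℝ, (deriv φ x) ^ 2)
      = 2 * (∫ x : ℝ, (φ x) ^ 2)
        - ((p + 3) / (2 * (p + 1))) * ∫ x : ℝ, |deriv φ x| ^ (p + 1) := by
  have hder : ∀ k < 4, ∀ x, HasDerivAt (iteratedDeriv k φ) (iteratedDeriv (k + 1) φ x) x := by
    intro k hk x
    rw [iteratedDeriv_succ]
    exact (hφ.differentiable_iteratedDeriv k (by exact_mod_cast hk) x).hasDerivAt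
  have ha := hder 0 (by norm_num)
  have hb := hder 1 (by norm_num)
  have hc := hder 2 (by norm_num)
  have hd := hder 3 (by norm_num)
  have da := hdecay 0 (by norm_num)
  have db := hdecay 1 (by norm_num)
  have dc := hdecay 2 (by norm_num)
  have dd := hdecay 3 (by norm_num)
  norm_num only [iteratedDeriv_zero, iteratedDeriv_one] at ha hb hc hd da db dc dd
  generalize deriv φ = b at *
  generalize iteratedDeriv 2 φ = c at *
  generalize iteratedDeriv 3 φ = d at *
  generalize iteratedDeriv 4 φ = e at *
  have hr : 0 < p - 1 := by linarith
  have hp1 : p + 1 ≠ 0 := by linarith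
  have hN : ∀ y : ℝ, |y| ^ (p + 1) = y * (|y| ^ (p - 1) * y) := by
    intro y
    rw [show p + 1 = (p - 1) + (2 : ℕ) by push_cast; ring,
      Real.rpow_add_natCast' (abs_nonneg y) (by push_cast; linarith), sq_abs]
    ring
  simp_rw [hN]
  have hg : ∀ x, HasDerivAt (fun x => |b x| ^ (p - 1) * b x) (p * |b x| ^ (p - 1) * c x) x := by
    intro x
    have h := (hasDerivAt_abs_rpow_mul_self hr (b x)).comp x (hb x)
    rwa [sub_add_cancel] at h
  have ca : Continuous φ := continuous_iff_continuousAt.2 fun x => (ha x).continuousAt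
  have cb : Continuous b := continuous_iff_continuousAt.2 fun x => (hb x).continuousAt
  have cc : Continuous c := continuous_iff_continuousAt.2 fun x => (hc x).continuousAt
  have cg : Continuous fun x => |b x| ^ (p - 1) * b x :=
    continuous_iff_continuousAt.2 fun x => (hg x).continuousAt
  have bound : ∀ {f : ℝ → ℝ}, (∀ x, |f x| ≤ C * Real.exp (-κ * |x|)) → ∀ x, |f x| ≤ C := by
    intro f hf x
    refine (hf x).trans (mul_le_of_le_one_right hC.le (Real.exp_le_one_iff.2 ?_))
    nlinarith [abs_nonneg x]
  have bg : ∀ x, |(|b x| ^ (p - 1) * b x)| ≤ C ^ (p - 1) * C := by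
    intro x
    rw [abs_mul, abs_of_nonneg (Real.rpow_nonneg (abs_nonneg _) _)]
    gcongr <;> exact bound db x
  have ta := tendsto_cocompact_zero_of_abs_le_exp hκ da
  have tb := tendsto_cocompact_zero_of_abs_le_exp hκ db
  have tc := tendsto_cocompact_zero_of_abs_le_exp hκ dc
  have td := tendsto_cocompact_zero_of_abs_le_exp hκ dd
  have ua := tendsto_cocompact_zero_of_abs_le_exp_mul hκ da
  have ub := tendsto_cocompact_zero_of_abs_le_exp_mul hκ db
  have uc := tendsto_cocompact_zero_of_abs_le_exp_mul hκ dc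
  have tg : Tendsto (fun x => |b x| ^ (p - 1) * b x) (cocompact ℝ) (𝓝 0) := by
    have h := ((hasDerivAt_abs_rpow_mul_self hr 0).continuousAt.tendsto).comp tb
    simpa only [Function.comp_def, mul_zero] using h
  have ia : Integrable fun x => φ x ^ 2 := by
    simpa only [sq] using integrable_mul_of_abs_le_exp hκ ca ca da (bound da)
  have ib : Integrable fun x => b x ^ 2 := by
    simpa only [sq] using integrable_mul_of_abs_le_exp hκ cb cb db (bound db)
  have ic : Integrable fun x => c x ^ 2 := by
    simpa only [sq] using integrable_mul_of_abs_le_exp hκ cc cc dc (bound dc)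
  have ig := integrable_mul_of_abs_le_exp hκ cb cg db bg
  have key : ∀ α β γ δ : ℝ,
      Integrable (fun x => α * φ x ^ 2 + β * b x ^ 2 + γ * c x ^ 2
        + δ * (b x * (|b x| ^ (p - 1) * b x))) ∧
      ∫ x, (α * φ x ^ 2 + β * b x ^ 2 + γ * c x ^ 2 + δ * (b x * (|b x| ^ (p - 1) * b x)))
        = α * (∫ x, φ x ^ 2) + β * (∫ x, b x ^ 2) + γ * (∫ x, c x ^ 2)
          + δ * ∫ x, b x * (|b x| ^ (p - 1) * b x) := by
    intro α β γ δ
    have i1 := ia.const_mul α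
    have i2 := ib.const_mul β
    have i3 := ic.const_mul γ
    have i4 := ig.const_mul δ
    have i12 : Integrable fun x => α * φ x ^ 2 + β * b x ^ 2 := i1.add i2
    have i123 : Integrable fun x => α * φ x ^ 2 + β * b x ^ 2 + γ * c x ^ 2 := i12.add i3
    refine ⟨i123.add i4, ?_⟩
    rw [integral_add i123 i4, integral_add i12 i3, integral_add i1 i2]
    simp only [integral_const_mul]
  -- the equation multiplied by `φ`
  have I1 := integral_eq_zero_of_hasDerivAt_of_tendsto_cocompact
    (F := fun x => φ x * d x - b x * c x + ω * (φ x * b x) + (|b x| ^ (p - 1) * b x) * φ x)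
    (F' := fun x => -1 * φ x ^ 2 + ω * b x ^ 2 + -1 * c x ^ 2
      + 1 * (b x * (|b x| ^ (p - 1) * b x)))
    (fun x => by
      have h := ((((ha x).mul (hd x)).sub ((hb x).mul (hc x))).add
        (((ha x).mul (hb x)).const_mul ω)).add ((hg x).mul (ha x))
      refine h.congr_deriv ?_
      linear_combination φ x * heq x)
    (key _ _ _ _).1
    (by simpa using (((ta.mul td).sub (tb.mul tc)).add ((ta.mul tb).const_mul ω)).add (tg.mul ta))
  -- the equation multiplied by `x φ'`
  have T2 : Tendsto (fun x => x * b x * d x - 1 / 2 * (x * c x * c x) + ω / 2 * (x * b x * b x)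
      + 1 / 2 * (x * φ x * φ x) + p / (p + 1) * (x * b x * (|b x| ^ (p - 1) * b x)) - b x * c x)
      (cocompact ℝ) (𝓝 0) := by
    have t1 := ub.mul td
    have t2 := (uc.mul tc).const_mul (1 / 2 : ℝ)
    have t3 := (ub.mul tb).const_mul (ω / 2)
    have t4 := (ua.mul ta).const_mul (1 / 2 : ℝ)
    have t5 := (ub.mul tg).const_mul (p / (p + 1))
    have t := ((((t1.sub t2).add t3).add t4).add t5).sub (tb.mul tc)
    simpa only [mul_zero, sub_zero, add_zero] using t
  have I2 := integral_eq_zero_of_hasDerivAt_of_tendsto_cocompact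
    (F := fun x => x * b x * d x - 1 / 2 * (x * c x * c x) + ω / 2 * (x * b x * b x)
      + 1 / 2 * (x * φ x * φ x) + p / (p + 1) * (x * b x * (|b x| ^ (p - 1) * b x)) - b x * c x)
    (F' := fun x => 1 / 2 * φ x ^ 2 + ω / 2 * b x ^ 2 + -3 / 2 * c x ^ 2
      + p / (p + 1) * (b x * (|b x| ^ (p - 1) * b x)))
    (fun x => by
      have xa := (hasDerivAt_id' x).mul (ha x)
      have xb := (hasDerivAt_id' x).mul (hb x)
      have xc := (hasDerivAt_id' x).mul (hc x)
      have h := (((((xb.mul (hd x)).sub ((xc.mul (hc x)).const_mul (1 / 2))).add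
        ((xb.mul (hb x)).const_mul (ω / 2))).add ((xa.mul (ha x)).const_mul (1 / 2))).add
        ((xb.mul (hg x)).const_mul (p / (p + 1)))).sub ((hb x).mul (hc x))
      refine h.congr_deriv ?_
      have hq : p / (p + 1) * (p + 1) = p := div_mul_cancel₀ p hp1
      simp only [Pi.mul_apply]
      linear_combination x * b x * heq x + x * b x * |b x| ^ (p - 1) * c x * hq)
    (key _ _ _ _).1
    T2
  rw [(key _ _ _ _).2] at I1 I2
  have h1 : (p - 1) / (2 * (p + 1)) = p / (p + 1) - 1 / 2 := by field_simp; ring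
  have h2 : (p + 3) / (2 * (p + 1)) = 3 / 2 - p / (p + 1) := by field_simp; ring
  rw [h1, h2]
  constructor
  · linear_combination 1 / 2 * I1 - I2
  · linear_combination 3 / 2 * I1 - I2
end

section
/- Let 1 < p < 5 and λ > 0. Then there exists a real constant C (depending on p and λ) such that every real Schwartz function u with ∫_ℝ u'(x)² dx = λ satisfies J[u] ≥ C and I[u] ≥ C. Moreover, I[u] ≥ J[u] for every such u. -/
open MeasureTheory

/-- The functional `I[u] = (1/2)∫ (u''² + u²) - (1/(p+1)) ∫ |u'|^p u'`. -/
noncomputable def Ifun (p : ℝ) (u : ℝ → ℝ) : ℝ :=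
  (1 / 2) * (∫ x : ℝ, ((deriv (deriv u) x) ^ 2 + (u x) ^ 2))
    - (1 / (p + 1)) * ∫ x : ℝ, |deriv u x| ^ p * deriv u x

/-- The functional `J[u] = (1/2)∫ (u''² + u²) - (1/(p+1)) ∫ |u'|^{p+1}`. -/
noncomputable def Jfun (p : ℝ) (u : ℝ → ℝ) : ℝ :=
  (1 / 2) * (∫ x : ℝ, ((deriv (deriv u) x) ^ 2 + (u x) ^ 2))
    - (1 / (p + 1)) * ∫ x : ℝ, |deriv u x| ^ (p + 1)

theorem SchwartzMap.integrable_sq (f : SchwartzMap ℝ ℝ) : Integrable (fun x ↦ f x ^ 2) :=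
  (f.memLp 2).integrable_sq

open Filter Topology in
/-- An Agmon-type inequality with a free scaling parameter. -/
theorem SchwartzMap.sq_le_mul_integral_deriv_sq_add (f : SchwartzMap ℝ ℝ) {ε : ℝ} (hε : 0 < ε)
    (x : ℝ) :
    f x ^ 2 ≤ ε * (∫ y, deriv f y ^ 2) + (∫ y, f y ^ 2) / ε := by
  have hf : Integrable (fun y ↦ f y ^ 2) := f.integrable_sq
  have hf' : Integrable (fun y ↦ deriv f y ^ 2) :=
    (SchwartzMap.derivCLM ℝ ℝ f).integrable_sq
  have hff' : Integrable (fun y ↦ 2 * f y * deriv f y) := by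
    have h : Integrable (fun y ↦ f y * deriv f y) :=
      (f.memLp 2).integrable_mul ((SchwartzMap.derivCLM ℝ ℝ f).memLp 2)
    simpa only [mul_assoc] using h.const_mul 2
  have hlim : Tendsto (fun y ↦ f y ^ 2) atBot (𝓝 0) := by
    have h : Tendsto f atBot (𝓝 0) := f.tendsto_cocompact.mono_left atBot_le_cocompact
    simpa using h.pow 2
  have hftc : ∫ y in Set.Iic x, 2 * f y * deriv f y = f x ^ 2 - 0 :=
    integral_Iic_of_hasDerivAt_of_tendsto'
      (fun y _ ↦ by simpa using (f.hasDerivAt y).fun_pow 2) hff'.integrableOn hlim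
  have hsum : Integrable (fun y ↦ ε * deriv f y ^ 2 + f y ^ 2 / ε) :=
    (hf'.const_mul ε).add (hf.div_const ε)
  calc f x ^ 2 = ∫ y in Set.Iic x, 2 * f y * deriv f y := by rw [hftc, sub_zero]
    _ ≤ ∫ y in Set.Iic x, (ε * deriv f y ^ 2 + f y ^ 2 / ε) := by
        refine integral_mono hff'.integrableOn hsum.integrableOn fun y ↦ ?_
        have h : ε * deriv f y ^ 2 + f y ^ 2 / ε - 2 * f y * deriv f y
            = (ε * deriv f y - f y) ^ 2 / ε := by
          field_simp
          ring
        have : 0 ≤ (ε * deriv f y - f y) ^ 2 / ε := by positivity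
        dsimp only
        linarith
    _ ≤ ∫ y, (ε * deriv f y ^ 2 + f y ^ 2 / ε) :=
        setIntegral_le_integral hsum (ae_of_all _ fun y ↦ by dsimp only [Pi.zero_apply]; positivity)
    _ = ε * (∫ y, deriv f y ^ 2) + (∫ y, f y ^ 2) / ε := by
        rw [integral_add (hf'.const_mul ε) (hf.div_const ε), integral_const_mul,
          integral_div]

theorem Real.abs_rpow_add_one_le_mul_sq {p a B : ℝ} (hp : 1 ≤ p) (ha : a ^ 2 ≤ B) :
    |a| ^ (p + 1) ≤ B ^ ((p - 1) / 2) * a ^ 2 := by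
  have h : |a| ^ (p + 1) = (a ^ 2) ^ ((p - 1) / 2) * a ^ 2 := by
    rw [← sq_abs a, ← Real.rpow_natCast, ← Real.rpow_mul (abs_nonneg a),
      ← Real.rpow_add_of_nonneg (abs_nonneg a) (by push_cast; linarith) (by positivity)]
    congr 1
    push_cast
    ring
  rw [h]
  gcongr

theorem Real.mul_rpow_le_half_add {K r t : ℝ} (hK : 0 ≤ K) (hr0 : 0 ≤ r) (hr1 : r < 1)
    (ht : 0 < t) :
    K * t ^ r ≤ t / 2 + K * ((2 * K) ^ (1 / (1 - r))) ^ r := by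
  have hr : 0 < 1 - r := by linarith
  rcases le_total (2 * K) (t ^ (1 - r)) with h | h
  · have h1 : t ^ (1 - r) * t ^ r = t := by
      rw [← Real.rpow_add ht, sub_add_cancel, Real.rpow_one]
    have h2 : 2 * K * t ^ r ≤ t ^ (1 - r) * t ^ r := by gcongr
    have h3 : 0 ≤ K * ((2 * K) ^ (1 / (1 - r))) ^ r := by positivity
    linarith
  · have h1 : t ≤ (2 * K) ^ (1 / (1 - r)) := by
      calc t = (t ^ (1 - r)) ^ (1 / (1 - r)) := by
            rw [← Real.rpow_mul ht.le, mul_one_div_cancel hr.ne', Real.rpow_one]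
        _ ≤ (2 * K) ^ (1 / (1 - r)) := by gcongr
    have h2 : K * t ^ r ≤ K * ((2 * K) ^ (1 / (1 - r))) ^ r := by gcongr
    linarith

theorem SchwartzMap.integrable_abs_rpow_add_one (f : SchwartzMap ℝ ℝ) {p : ℝ} (hp : 1 ≤ p) :
    Integrable (fun x ↦ |f x| ^ (p + 1)) := by
  have hf : Integrable (fun y ↦ f y ^ 2) := f.integrable_sq
  refine (hf.const_mul
    ((1 * (∫ y, deriv f y ^ 2) + (∫ y, f y ^ 2) / 1) ^ ((p - 1) / 2))).mono' ?_
    (ae_of_all _ fun x ↦ ?_)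
  · exact (f.continuous.abs.rpow_const fun _ ↦ Or.inr (by linarith)).aestronglyMeasurable
  · rw [Real.norm_of_nonneg (by positivity)]
    exact Real.abs_rpow_add_one_le_mul_sq hp (f.sq_le_mul_integral_deriv_sq_add one_pos x)

/-- A Gagliardo–Nirenberg-type inequality, with a nonhomogeneous right-hand side. -/
theorem SchwartzMap.integral_abs_rpow_add_one_le (f : SchwartzMap ℝ ℝ) {p : ℝ} (hp : 1 ≤ p) :
    ∫ x, |f x| ^ (p + 1) ≤ (1 + ∫ x, f x ^ 2) ^ ((p - 1) / 2) * (∫ x, f x ^ 2) *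
      (1 + ∫ x, deriv f x ^ 2) ^ ((p - 1) / 4) := by
  set A := ∫ x, deriv f x ^ 2
  set L := ∫ x, f x ^ 2
  have hA : 0 ≤ A := integral_nonneg fun x ↦ sq_nonneg _
  have hL : 0 ≤ L := integral_nonneg fun x ↦ sq_nonneg _
  have hf : Integrable (fun y ↦ f y ^ 2) := f.integrable_sq
  have hs : 0 < √(1 + A) := by positivity
  have hsq : √(1 + A) ^ 2 = 1 + A := Real.sq_sqrt (by positivity)
  have hsup (x : ℝ) : f x ^ 2 ≤ (1 + L) * √(1 + A) := by
    refine (f.sq_le_mul_integral_deriv_sq_add (inv_pos.mpr hs) x).trans ?_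
    change (√(1 + A))⁻¹ * A + L / (√(1 + A))⁻¹ ≤ _
    have : (√(1 + A))⁻¹ * A ≤ √(1 + A) := by
      rw [inv_mul_le_iff₀ hs]
      nlinarith
    rw [div_inv_eq_mul]
    linarith
  calc ∫ x, |f x| ^ (p + 1)
      ≤ ∫ x, ((1 + L) * √(1 + A)) ^ ((p - 1) / 2) * f x ^ 2 :=
        integral_mono (f.integrable_abs_rpow_add_one hp) (hf.const_mul _) fun x ↦
          Real.abs_rpow_add_one_le_mul_sq hp (hsup x)
    _ = (1 + L) ^ ((p - 1) / 2) * L * (1 + A) ^ ((p - 1) / 4) := by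
        have hr : √(1 + A) ^ ((p - 1) / 2) = (1 + A) ^ ((p - 1) / 4) := by
          rw [Real.sqrt_eq_rpow, ← Real.rpow_mul (by positivity)]
          congr 1
          ring
        rw [integral_const_mul, Real.mul_rpow (by positivity) hs.le, hr]
        ring

theorem Jfun_le_Ifun {p : ℝ} (hp : 1 ≤ p) (u : SchwartzMap ℝ ℝ) : Jfun p u ≤ Ifun p u := by
  set f := SchwartzMap.derivCLM ℝ ℝ u
  have hint := f.integrable_abs_rpow_add_one hp
  have hpt (x : ℝ) : |f x| ^ (p + 1) = |f x| ^ p * |f x| :=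
    Real.rpow_add_one' (abs_nonneg _) (by linarith)
  have hint' : Integrable (fun x ↦ |f x| ^ p * f x) := by
    refine hint.mono' ?_ (ae_of_all _ fun x ↦ ?_)
    · exact ((f.continuous.abs.rpow_const fun _ ↦ Or.inr (by linarith)).mul
        f.continuous).aestronglyMeasurable
    · rw [hpt, norm_mul, Real.norm_of_nonneg (by positivity), Real.norm_eq_abs]
  have hle : ∫ x, |f x| ^ p * f x ≤ ∫ x, |f x| ^ (p + 1) :=
    integral_mono hint' hint fun x ↦ by
      dsimp only
      rw [hpt]
      gcongr
      exact le_abs_self _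
  have hle' : 1 / (p + 1) * ∫ x, |f x| ^ p * f x ≤ 1 / (p + 1) * ∫ x, |f x| ^ (p + 1) := by
    have : 0 ≤ 1 / (p + 1) := by positivity
    gcongr
  exact sub_le_sub_left hle' _

/-- For `1 < p < 5` the functionals `I` and `J` are bounded below on the constraint set
`∫ u'² = λ`, and `I[u] ≥ J[u]` there. -/
theorem I_and_J_bounded_below (p lam : ℝ) (hp1 : 1 < p) (hp5 : p < 5) (hlam : 0 < lam) :
    ∃ C : ℝ, ∀ u : SchwartzMap ℝ ℝ, (∫ x : ℝ, (deriv u x) ^ 2) = lam →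
      C ≤ Jfun p u ∧ C ≤ Ifun p u ∧ Jfun p u ≤ Ifun p u := by
  set K : ℝ := 1 / (p + 1) * ((1 + lam) ^ ((p - 1) / 2) * lam)
  have hK : 0 ≤ K := by positivity
  refine ⟨-(1 / 2) - K * ((2 * K) ^ (1 / (1 - (p - 1) / 4))) ^ ((p - 1) / 4), fun u hu ↦ ?_⟩
  suffices hJ : _ ≤ Jfun p u from
    ⟨hJ, hJ.trans (Jfun_le_Ifun hp1.le u), Jfun_le_Ifun hp1.le u⟩
  have hGN : ∫ x, |deriv u x| ^ (p + 1) ≤ (1 + ∫ x, deriv u x ^ 2) ^ ((p - 1) / 2) *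
      (∫ x, deriv u x ^ 2) * (1 + ∫ x, deriv (deriv u) x ^ 2) ^ ((p - 1) / 4) :=
    (SchwartzMap.derivCLM ℝ ℝ u).integral_abs_rpow_add_one_le hp1.le
  rw [hu] at hGN
  have hu0 : Integrable (fun x ↦ u x ^ 2) := u.integrable_sq
  have hu2 : Integrable (fun x ↦ deriv (deriv u) x ^ 2) :=
    (SchwartzMap.derivCLM ℝ ℝ (SchwartzMap.derivCLM ℝ ℝ u)).integrable_sq
  have hu0_nonneg : 0 ≤ ∫ x, u x ^ 2 := integral_nonneg fun x ↦ sq_nonneg _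
  have hA : 0 ≤ ∫ x, deriv (deriv u) x ^ 2 := integral_nonneg fun x ↦ sq_nonneg _
  rw [Jfun, integral_add hu2 hu0]
  set A := ∫ x, deriv (deriv u) x ^ 2
  have hY := Real.mul_rpow_le_half_add hK (r := (p - 1) / 4) (by linarith) (by linarith)
    (show 0 < 1 + A by linarith)
  have hN : 1 / (p + 1) * ∫ x, |deriv u x| ^ (p + 1) ≤ K * (1 + A) ^ ((p - 1) / 4) := by
    rw [mul_assoc (1 / (p + 1))]
    gcongr
  linarith
end

section
/- Let 1 < p < 5 and λ > 0. Then there exists a real Schwartz function u with ∫_ℝ u'(x)² dx = λ and J[u] < λ. In particular, m_J(λ) := inf{ J[u] : u a real Schwartz function with ∫_ℝ u'(x)² dx = λ } satisfies m_J(λ) < λ. -/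
open MeasureTheory

/-- Lower bound for the `L^{p+1}` integral of a function supported in `[-R, R]` in terms of its
`L²` integral and a threshold `t`. -/
theorem rpow_mul_integral_sq_sub_le {p t R : ℝ} (hp : 1 < p) (ht : 0 ≤ t) (hR : 0 ≤ R)
    {v : ℝ → ℝ} (hv : Continuous v) (hsupp : ∀ x ∉ Set.Icc (-R) R, v x = 0) :
    t ^ (p - 1) * ((∫ x, v x ^ 2) - t ^ 2 * (2 * R)) ≤ ∫ x, |v x| ^ (p + 1) := by
  rw [← setIntegral_eq_integral_of_forall_compl_eq_zero (s := Set.Icc (-R) R)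
      (f := fun x => v x ^ 2) (fun x hx => by simp [hsupp x hx]),
    ← setIntegral_eq_integral_of_forall_compl_eq_zero (s := Set.Icc (-R) R)
      (f := fun x => |v x| ^ (p + 1))
      (fun x hx => by simp [hsupp x hx, Real.zero_rpow (by linarith : p + 1 ≠ 0)])]
  have hsq : IntegrableOn (fun x => v x ^ 2) (Set.Icc (-R) R) :=
    (hv.pow 2).continuousOn.integrableOn_Icc
  have hconst : IntegrableOn (fun _ : ℝ => t ^ 2) (Set.Icc (-R) R) :=
    continuousOn_const.integrableOn_Icc
  have hpow : IntegrableOn (fun x => |v x| ^ (p + 1)) (Set.Icc (-R) R) :=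
    (hv.abs.rpow_const fun _ => Or.inr (by linarith)).continuousOn.integrableOn_Icc
  calc t ^ (p - 1) * ((∫ x in Set.Icc (-R) R, v x ^ 2) - t ^ 2 * (2 * R))
      = ∫ x in Set.Icc (-R) R, t ^ (p - 1) * (v x ^ 2 - t ^ 2) := by
        rw [integral_const_mul, integral_sub hsq hconst, setIntegral_const]
        simp only [Measure.real, Real.volume_Icc, smul_eq_mul]
        rw [ENNReal.toReal_ofReal (by linarith)]
        ring
    _ ≤ _ := by
        refine integral_mono ((hsq.sub hconst).const_mul _) hpow fun x => ?_
        have hfac : |v x| ^ (p + 1) = |v x| ^ (p - 1) * v x ^ 2 := by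
          rw [show p + 1 = (p - 1) + 2 by ring,
            Real.rpow_add_of_nonneg (abs_nonneg _) (by linarith) (by norm_num), Real.rpow_two,
            sq_abs]
        have htp : 0 ≤ t ^ (p - 1) := Real.rpow_nonneg ht _
        have hvp : 0 ≤ |v x| ^ (p - 1) := Real.rpow_nonneg (abs_nonneg _) _
        simp only [hfac]
        rcases le_total t |v x| with h | h
        · have := Real.rpow_le_rpow ht h (by linarith : 0 ≤ p - 1)
          nlinarith [mul_le_mul_of_nonneg_right this (sq_nonneg (v x)),
            mul_nonneg htp (sq_nonneg t)]
        · have : v x ^ 2 ≤ t ^ 2 := by rw [← sq_abs (v x)]; gcongr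
          nlinarith [mul_nonneg hvp (sq_nonneg (v x)), mul_nonneg htp (sub_nonneg.2 this)]

theorem Continuous.integrable_sq_of_hasCompactSupport {f : ℝ → ℝ} (hf : Continuous f)
    (hc : HasCompactSupport f) : Integrable fun x => f x ^ 2 := by
  simp only [pow_two]
  exact (hf.mul hf).integrable_of_hasCompactSupport hc.mul_right

/-- Integrating by parts, the quadratic part of `J` is `∫ u'² + (1/2) ∫ (u'' + u)²`. -/
theorem Jfun_eq_integral_deriv_sq_add {u : ℝ → ℝ} (hu : ContDiff ℝ (⊤ : ℕ∞) u)
    (hc : HasCompactSupport u) (p : ℝ) :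
    Jfun p u = (∫ x, deriv u x ^ 2) + 1 / 2 * (∫ x, (deriv (deriv u) x + u x) ^ 2)
      - 1 / (p + 1) * ∫ x, |deriv u x| ^ (p + 1) := by
  have hu' : ContDiff ℝ (⊤ : ℕ∞) (deriv u) := (contDiff_infty_iff_deriv.1 hu).2
  have hu'' : ContDiff ℝ (⊤ : ℕ∞) (deriv (deriv u)) := (contDiff_infty_iff_deriv.1 hu').2
  have h1 : Integrable fun x => u x * deriv (deriv u) x :=
    (hu.continuous.mul hu''.continuous).integrable_of_hasCompactSupport hc.mul_right
  have h2 : Integrable fun x => deriv u x * deriv u x :=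
    (hu'.continuous.mul hu'.continuous).integrable_of_hasCompactSupport hc.deriv.mul_right
  have h3 : Integrable fun x => u x * deriv u x :=
    (hu.continuous.mul hu'.continuous).integrable_of_hasCompactSupport hc.mul_right
  have h4 : Integrable fun x => deriv (deriv u) x ^ 2 + u x ^ 2 :=
    (hu''.continuous.integrable_sq_of_hasCompactSupport hc.deriv.deriv).add
      (hu.continuous.integrable_sq_of_hasCompactSupport hc)
  have hparts : ∫ x, u x * deriv (deriv u) x = -∫ x, deriv u x * deriv u x :=
    integral_mul_deriv_eq_deriv_mul_of_integrable
      (fun x _ => (hu.differentiable (by simp) x).hasDerivAt)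
      (fun x _ => (hu'.differentiable (by simp) x).hasDerivAt) h1 h2 h3
  have hexp : ∫ x, (deriv (deriv u) x + u x) ^ 2
      = (∫ x, (deriv (deriv u) x ^ 2 + u x ^ 2)) + 2 * ∫ x, u x * deriv (deriv u) x := by
    rw [← integral_const_mul, ← integral_add h4 (h1.const_mul 2)]
    exact integral_congr_ae (.of_forall fun x => by ring)
  rw [Jfun, hexp, hparts]
  simp only [← pow_two]
  ring

/-- Cutting off `cos` at scale `R = n π` gives a function of mass at least `R` that solves
`u'' + u = 0` up to an error `O(1 / R)`. -/
theorem exists_contDiff_approx_harmonic : ∃ K : ℝ, ∀ n : ℕ, 1 ≤ n → ∃ u : ℝ → ℝ,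
    ContDiff ℝ (⊤ : ℕ∞) u ∧ (∀ x ∉ Set.Icc (-(2 * (n * Real.pi))) (2 * (n * Real.pi)), u x = 0) ∧
    n * Real.pi ≤ ∫ x, deriv u x ^ 2 ∧
    ∀ x, |deriv (deriv u) x + u x| ≤ K / (n * Real.pi) := by
  let φ : ContDiffBump (0 : ℝ) := ⟨1, 2, by norm_num, by norm_num⟩
  have hφ : ContDiff ℝ (⊤ : ℕ∞) φ := φ.contDiff
  have hφ' : ContDiff ℝ (⊤ : ℕ∞) (deriv φ) := (contDiff_infty_iff_deriv.1 hφ).2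
  have hφ'' : ContDiff ℝ (⊤ : ℕ∞) (deriv (deriv φ)) := (contDiff_infty_iff_deriv.1 hφ').2
  have hφc : HasCompactSupport φ := φ.hasCompactSupport
  obtain ⟨C₁, hC₁⟩ := hφc.deriv.exists_bound_of_continuous hφ'.continuous
  obtain ⟨C₂, hC₂⟩ := hφc.deriv.deriv.exists_bound_of_continuous hφ''.continuous
  refine ⟨C₂ + 2 * C₁, fun n hn => ?_⟩
  set R : ℝ := n * Real.pi with hR
  have hn1 : (1 : ℝ) ≤ n := by exact_mod_cast hn
  have hR1 : 1 ≤ R := by nlinarith [Real.pi_gt_three]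
  have hR0 : 0 < R := by linarith
  have hscale : ∀ x, HasDerivAt (fun y : ℝ => y / R) (1 / R) x :=
    fun x => (hasDerivAt_id x).div_const R
  have hd1 : ∀ x, HasDerivAt (fun x => φ (x / R) * Real.cos x)
      (deriv φ (x / R) * (1 / R) * Real.cos x + φ (x / R) * -Real.sin x) x := fun x =>
    ((hφ.differentiable (by simp) _).hasDerivAt.comp x (hscale x)).mul (Real.hasDerivAt_cos x)
  have hd2 : ∀ x, HasDerivAt
      (fun x => deriv φ (x / R) * (1 / R) * Real.cos x + φ (x / R) * -Real.sin x)
      (deriv (deriv φ) (x / R) * (1 / R) * (1 / R) * Real.cos x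
        + deriv φ (x / R) * (1 / R) * -Real.sin x
        + (deriv φ (x / R) * (1 / R) * -Real.sin x + φ (x / R) * -Real.cos x)) x := fun x =>
    ((((hφ'.differentiable (by simp) _).hasDerivAt.comp x (hscale x)).mul_const (1 / R)).mul
      (Real.hasDerivAt_cos x)).add
      (((hφ.differentiable (by simp) _).hasDerivAt.comp x (hscale x)).mul
        (Real.hasDerivAt_sin x).neg)
  have hu : ContDiff ℝ (⊤ : ℕ∞) (fun x => φ (x / R) * Real.cos x) :=
    (hφ.comp (contDiff_id.div_const R)).mul Real.contDiff_cos
  have hsupp : ∀ x ∉ Set.Icc (-(2 * R)) (2 * R), φ (x / R) * Real.cos x = 0 := by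
    intro x hx
    rw [φ.zero_of_le_dist, zero_mul]
    rw [Real.dist_eq, sub_zero, abs_div, abs_of_pos hR0, le_div_iff₀ hR0]
    by_contra! h
    exact hx (abs_le.1 h.le)
  have huc : HasCompactSupport (fun x => φ (x / R) * Real.cos x) :=
    HasCompactSupport.intro isCompact_Icc hsupp
  refine ⟨fun x => φ (x / R) * Real.cos x, hu, hsupp, ?_, fun x => ?_⟩
  · have hu' := (contDiff_infty_iff_deriv.1 hu).2.continuous
    have hint : Integrable fun x => deriv (fun x => φ (x / R) * Real.cos x) x ^ 2 :=
      hu'.integrable_sq_of_hasCompactSupport huc.deriv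
    have hin : ∀ x ∈ Set.Ioo (-R) R,
        deriv (fun x => φ (x / R) * Real.cos x) x ^ 2 = Real.sin x ^ 2 := by
      intro x hx
      have heq : (fun x => φ (x / R) * Real.cos x) =ᶠ[nhds x] Real.cos := by
        filter_upwards [isOpen_Ioo.mem_nhds hx] with y hy
        rw [φ.one_of_mem_closedBall, one_mul]
        rw [Metric.mem_closedBall, Real.dist_eq, sub_zero, abs_div, abs_of_pos hR0,
          div_le_iff₀ hR0]
        simpa [φ] using (abs_lt.2 hy).le
      rw [heq.deriv_eq, Real.deriv_cos, neg_sq]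
    calc R = ∫ x in (-R)..R, Real.sin x ^ 2 := by
          rw [integral_sin_sq, Real.sin_neg, hR, Real.sin_nat_mul_pi]; ring
      _ = ∫ x in Set.Ioo (-R) R, deriv (fun x => φ (x / R) * Real.cos x) x ^ 2 := by
          rw [intervalIntegral.integral_of_le (by linarith), integral_Ioc_eq_integral_Ioo]
          exact (setIntegral_congr_fun measurableSet_Ioo hin).symm
      _ ≤ _ := setIntegral_le_integral hint (.of_forall fun x => sq_nonneg _)
  · have e1 : deriv (fun x => φ (x / R) * Real.cos x) = _ := funext fun x => (hd1 x).deriv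
    rw [e1, (hd2 x).deriv]
    have b1 : |deriv φ (x / R)| ≤ C₁ := hC₁ _
    have b2 : |deriv (deriv φ) (x / R)| ≤ C₂ := hC₂ _
    have hC₂0 : 0 ≤ C₂ := (abs_nonneg _).trans b2
    have hrw : deriv (deriv φ) (x / R) * (1 / R) * (1 / R) * Real.cos x
        + deriv φ (x / R) * (1 / R) * -Real.sin x
        + (deriv φ (x / R) * (1 / R) * -Real.sin x + φ (x / R) * -Real.cos x)
        + φ (x / R) * Real.cos x
        = (deriv (deriv φ) (x / R) * Real.cos x * (1 / R)
          - 2 * (deriv φ (x / R) * Real.sin x)) / R := by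
      ring
    rw [hrw, abs_div, abs_of_pos hR0]
    gcongr
    refine (abs_sub _ _).trans ?_
    have hinv : 1 / R ≤ 1 := (div_le_one hR0).2 hR1
    have hinv0 : 0 ≤ 1 / R := by positivity
    have c1 : |deriv (deriv φ) (x / R) * Real.cos x * (1 / R)| ≤ C₂ := by
      rw [abs_mul, abs_mul, abs_of_nonneg hinv0]
      calc _ ≤ C₂ * 1 * 1 := by gcongr; exact Real.abs_cos_le_one x
        _ = C₂ := by ring
    have c2 : |2 * (deriv φ (x / R) * Real.sin x)| ≤ 2 * C₁ := by
      rw [abs_mul, abs_mul, abs_two]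
      have : |deriv φ (x / R)| * |Real.sin x| ≤ C₁ * 1 := by
        gcongr
        · exact (abs_nonneg _).trans b1
        · exact Real.abs_sin_le_one x
      linarith
    linarith

/-- The value of `J` on the multiple of an almost harmonic function which has mass `lam`. -/
theorem Jfun_const_mul_le {p lam R K : ℝ} (hp : 1 < p) (hlam : 0 < lam) (hR : 0 < R)
    {u : ℝ → ℝ} (hu : ContDiff ℝ (⊤ : ℕ∞) u)
    (hsupp : ∀ x ∉ Set.Icc (-(2 * R)) (2 * R), u x = 0)
    (hmass : R ≤ ∫ x, deriv u x ^ 2) (hK : ∀ x, |deriv (deriv u) x + u x| ≤ K / R) :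
    ∃ a : ℝ, (∫ x, deriv (fun y => a * u y) x ^ 2) = lam ∧
      Jfun p (fun y => a * u y) ≤ lam + lam * (2 * K ^ 2 * R ^ (-2 : ℝ)
        - 1 / (2 * (p + 1)) * (lam / 8) ^ ((p - 1) / 2) * R ^ (-((p - 1) / 2))) := by
  set N := ∫ x, deriv u x ^ 2 with hN
  have hN0 : 0 < N := hR.trans_le hmass
  set a := √(lam / N)
  have ha2 : a ^ 2 = lam / N := Real.sq_sqrt (by positivity)
  have hc : HasCompactSupport u := HasCompactSupport.intro isCompact_Icc hsupp
  have hdu : deriv (fun y => a * u y) = fun y => a * deriv u y := by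
    ext y; simp
  have hddu : deriv (fun y => a * deriv u y) = fun y => a * deriv (deriv u) y := by
    ext y; simp
  have hnorm : (∫ x, deriv (fun y => a * u y) x ^ 2) = lam := by
    simp only [hdu, mul_pow, integral_const_mul]
    rw [ha2, ← hN]; field_simp
  have hu' := (contDiff_infty_iff_deriv.1 hu).2
  have hu'' := (contDiff_infty_iff_deriv.1 hu').2
  have htsupp : tsupport u ⊆ Set.Icc (-(2 * R)) (2 * R) :=
    closure_minimal (fun x hx => by_contra fun h => hx (hsupp x h)) isClosed_Icc
  have hsupp' : ∀ x ∉ Set.Icc (-(2 * R)) (2 * R), deriv u x = 0 := fun x hx =>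
    image_eq_zero_of_notMem_tsupport fun h => hx (htsupp (tsupport_deriv_subset h))
  have hsupp'' : ∀ x ∉ Set.Icc (-(2 * R)) (2 * R), deriv (deriv u) x = 0 := fun x hx =>
    image_eq_zero_of_notMem_tsupport fun h =>
      hx (htsupp (tsupport_deriv_subset (tsupport_deriv_subset h)))
  refine ⟨a, hnorm, ?_⟩
  have hdefect : ∫ x, (deriv (deriv fun y => a * u y) x + a * u x) ^ 2
      ≤ lam * (4 * K ^ 2 * R ^ (-2 : ℝ)) := by
    simp only [hdu, hddu, ← mul_add, mul_pow, integral_const_mul]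
    have hbound : ∫ x, (deriv (deriv u) x + u x) ^ 2 ≤ (K / R) ^ 2 * (4 * R) := by
      rw [← setIntegral_eq_integral_of_forall_compl_eq_zero (s := Set.Icc (-(2 * R)) (2 * R))
        (fun x hx => by simp [hsupp x hx, hsupp'' x hx])]
      calc _ ≤ ∫ x in Set.Icc (-(2 * R)) (2 * R), (K / R) ^ 2 := by
            refine integral_mono
              ((hu''.continuous.add hu.continuous).pow 2).continuousOn.integrableOn_Icc
              continuousOn_const.integrableOn_Icc fun x => ?_
            simpa only [sq_abs] using pow_le_pow_left₀ (abs_nonneg _) (hK x) 2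
        _ = _ := by
            rw [setIntegral_const]
            simp only [Measure.real, Real.volume_Icc, smul_eq_mul]
            rw [ENNReal.toReal_ofReal (by linarith)]
            ring
    calc a ^ 2 * _ ≤ lam / R * ((K / R) ^ 2 * (4 * R)) := by
          rw [ha2]
          gcongr
      _ = _ := by
          rw [Real.rpow_neg hR.le, Real.rpow_two]; field_simp
  have hgain := rpow_mul_integral_sq_sub_le (t := √(lam / (8 * R))) hp (Real.sqrt_nonneg _)
    (by linarith : 0 ≤ 2 * R) (v := deriv fun y => a * u y)
    (by rw [hdu]; exact continuous_const.mul hu'.continuous)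
    (fun x hx => by simp [hdu, hsupp' x hx])
  rw [hnorm, Real.sq_sqrt (by positivity)] at hgain
  have ht : √(lam / (8 * R)) ^ (p - 1) = (lam / 8) ^ ((p - 1) / 2) * R ^ (-((p - 1) / 2)) := by
    rw [Real.sqrt_eq_rpow, ← Real.rpow_mul (by positivity), Real.rpow_neg hR.le, ← div_eq_mul_inv,
      ← Real.div_rpow (by positivity) hR.le]
    congr 1
    · field_simp
    · ring
  rw [ht, show lam - lam / (8 * R) * (2 * (2 * R)) = lam / 2 by field_simp; ring] at hgain
  rw [Jfun_eq_integral_deriv_sq_add (contDiff_const.mul hu) hc.mul_left, hnorm]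
  have hp0 : 0 < 1 / (p + 1) := one_div_pos.2 (by linarith)
  have hg := mul_le_mul_of_nonneg_left hgain hp0.le
  have hh : 1 / (2 * (p + 1)) = 1 / (p + 1) / 2 := by rw [div_div, mul_comm]
  rw [hh]
  linarith

theorem exists_nat_mul_pi_rpow_lt {K c q : ℝ} (hc : 0 < c) (hq : q < 2) :
    ∃ n : ℕ, 1 ≤ n ∧ K * (n * Real.pi) ^ (-2 : ℝ) < c * (n * Real.pi) ^ (-q) := by
  have hlim : Filter.Tendsto (fun n : ℕ => K * ((n : ℝ) * Real.pi) ^ (-(2 - q)))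
      Filter.atTop (nhds (K * 0)) :=
    ((tendsto_rpow_neg_atTop (sub_pos.2 hq)).comp
      (tendsto_natCast_atTop_atTop.atTop_mul_const Real.pi_pos)).const_mul K
  rw [mul_zero] at hlim
  obtain ⟨n, hn, hn1⟩ := ((hlim.eventually_lt_const hc).and (Filter.eventually_ge_atTop 1)).exists
  refine ⟨n, hn1, ?_⟩
  have hR : 0 < (n : ℝ) * Real.pi := mul_pos (by exact_mod_cast hn1) Real.pi_pos
  rw [show (-2 : ℝ) = -(2 - q) + -q by ring, Real.rpow_add hR, ← mul_assoc]
  exact mul_lt_mul_of_pos_right hn (Real.rpow_pos_of_pos hR _)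

/-- For `1 < p < 5` and `λ > 0` there is a Schwartz function on the constraint set with
`J[u] < λ`; in particular the infimum `m_J(λ)` satisfies `m_J(λ) < λ`. -/
theorem mJ_lt_lambda (p lam : ℝ) (hp1 : 1 < p) (hp5 : p < 5) (hlam : 0 < lam) :
    (∃ u : SchwartzMap ℝ ℝ, (∫ x : ℝ, (deriv u x) ^ 2) = lam ∧ Jfun p u < lam) ∧
    sInf {r : ℝ | ∃ u : SchwartzMap ℝ ℝ,
      (∫ x : ℝ, (deriv u x) ^ 2) = lam ∧ Jfun p u = r} < lam := by
  have key : ∃ u : SchwartzMap ℝ ℝ, (∫ x : ℝ, (deriv u x) ^ 2) = lam ∧ Jfun p u < lam := by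
    obtain ⟨K, hK⟩ := exists_contDiff_approx_harmonic
    have hp0 : 0 < p + 1 := by linarith
    obtain ⟨n, hn1, hn⟩ := exists_nat_mul_pi_rpow_lt (K := 2 * K ^ 2)
      (c := 1 / (2 * (p + 1)) * (lam / 8) ^ ((p - 1) / 2)) (q := (p - 1) / 2)
      (by positivity) (by linarith)
    obtain ⟨u, hu, hsupp, hmass, hdefect⟩ := hK n hn1
    have hR : 0 < (n : ℝ) * Real.pi := mul_pos (by exact_mod_cast hn1) Real.pi_pos
    obtain ⟨a, hnorm, hJ⟩ := Jfun_const_mul_le hp1 hlam hR hu hsupp hmass hdefect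
    have hc : HasCompactSupport fun y => a * u y :=
      (HasCompactSupport.intro isCompact_Icc hsupp).mul_left
    refine ⟨hc.toSchwartzMap (contDiff_const.mul hu), hnorm, hJ.trans_lt ?_⟩
    linarith [mul_neg_of_pos_of_neg hlam (sub_neg.2 hn)]
  refine ⟨key, ?_⟩
  obtain ⟨u, hu, hJ⟩ := key
  by_cases hb : BddBelow {r : ℝ | ∃ u : SchwartzMap ℝ ℝ,
      (∫ x : ℝ, (deriv u x) ^ 2) = lam ∧ Jfun p u = r}
  · exact (csInf_le hb ⟨u, hu, rfl⟩).trans_lt hJ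
  · rwa [Real.sInf_of_not_bddBelow hb]
end

section
/- Let 1 < p < 3 and λ > 0. Then there exists a real Schwartz function u with ∫_ℝ u'(x)² dx = λ and I[u] < λ. In particular, m_I(λ) := inf{ I[u] : u a real Schwartz function with ∫_ℝ u'(x)² dx = λ } satisfies m_I(λ) < λ. -/
open MeasureTheory

/-- The Gaussian `exp (-(e x)²)`. -/
noncomputable def gau (e x : ℝ) : ℝ := Real.exp (-(e ^ 2 * x ^ 2))

lemma gau_pos (e x : ℝ) : 0 < gau e x := Real.exp_pos _

lemma hasDerivAt_gau (e x : ℝ) : HasDerivAt (gau e) (-2 * e ^ 2 * x * gau e x) x := by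
  have h := (((hasDerivAt_pow 2 x).const_mul (e ^ 2)).neg).exp
  refine h.congr_deriv ?_
  simp only [gau, Pi.neg_apply]
  push_cast
  ring

lemma continuous_gau (e : ℝ) : Continuous (gau e) := by
  unfold gau; fun_prop

lemma integrable_gau {e : ℝ} (he : 0 < e) : Integrable (gau e) := by
  have h := integrable_exp_neg_mul_sq (b := e ^ 2) (by positivity)
  refine h.congr (Filter.Eventually.of_forall fun x => ?_)
  simp [gau]

lemma integral_gau {e : ℝ} (he : 0 < e) : ∫ x, gau e x = Real.sqrt Real.pi / e := by
  have h := integral_gaussian (e ^ 2)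
  rw [Real.sqrt_div' _ (by positivity), Real.sqrt_sq he.le] at h
  rw [← h]
  simp [gau]

lemma abs_pow_mul_gau_le {e : ℝ} (he : 0 < e) (k : ℕ) : ∃ C, ∀ x, |x| ^ k * gau e x ≤ C := by
  refine ⟨1 + k.factorial / (e ^ 2) ^ k, fun x => ?_⟩
  have h1 : gau e x ≤ 1 := by
    rw [gau, Real.exp_le_one_iff]; nlinarith [mul_nonneg (sq_nonneg e) (sq_nonneg x)]
  have h2 := Real.pow_div_factorial_le_exp (e ^ 2 * x ^ 2) (by positivity) k
  have h3 : (x ^ 2) ^ k * gau e x ≤ k.factorial / (e ^ 2) ^ k := by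
    rw [gau, Real.exp_neg, ← div_eq_mul_inv, div_le_div_iff₀ (Real.exp_pos _) (by positivity)]
    rw [div_le_iff₀ (by positivity), mul_pow] at h2
    linarith
  have h4 : |x| ^ k ≤ 1 + (x ^ 2) ^ k := by
    rcases le_total |x| 1 with h | h
    · have := pow_le_one₀ (n := k) (abs_nonneg x) h
      have : 0 ≤ (x ^ 2) ^ k := by positivity
      linarith
    · rw [← sq_abs, ← pow_mul]
      have := pow_le_pow_right₀ h (show k ≤ 2 * k by lia)
      linarith
  calc |x| ^ k * gau e x ≤ (1 + (x ^ 2) ^ k) * gau e x :=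
        mul_le_mul_of_nonneg_right h4 (gau_pos e x).le
    _ ≤ _ := by linarith

lemma abs_eval_mul_gau_le {e : ℝ} (he : 0 < e) (P : Polynomial ℝ) :
    ∃ C, ∀ x, |P.eval x| * gau e x ≤ C := by
  induction P using Polynomial.induction_on' with
  | add P Q hP hQ =>
    obtain ⟨C, hC⟩ := hP
    obtain ⟨D, hD⟩ := hQ
    refine ⟨C + D, fun x => ?_⟩
    rw [Polynomial.eval_add]
    nlinarith [abs_add_le (P.eval x) (Q.eval x), gau_pos e x, hC x, hD x]
  | monomial n c =>
    obtain ⟨C, hC⟩ := abs_pow_mul_gau_le he n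
    refine ⟨|c| * C, fun x => ?_⟩
    rw [Polynomial.eval_monomial, abs_mul, abs_pow, mul_assoc]
    exact mul_le_mul_of_nonneg_left (hC x) (abs_nonneg c)

/-- A Gaussian times a trigonometric polynomial of frequency `m` with polynomial coefficients. -/
noncomputable def gauTrig (e m : ℝ) (P Q : Polynomial ℝ) (x : ℝ) : ℝ :=
  gau e x * (P.eval x * Real.cos (m * x) + Q.eval x * Real.sin (m * x))

open Polynomial in
lemma deriv_gauTrig (e m : ℝ) (P Q : Polynomial ℝ) :
    deriv (gauTrig e m P Q) = gauTrig e m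
      (derivative P + C m * Q - C (2 * e ^ 2) * X * P)
      (derivative Q - C m * P - C (2 * e ^ 2) * X * Q) := by
  funext x
  have hm : HasDerivAt (fun x : ℝ => m * x) m x := by
    simpa using (hasDerivAt_id x).const_mul m
  have h := (hasDerivAt_gau e x).mul
    (((P.hasDerivAt x).mul hm.cos).add ((Q.hasDerivAt x).mul hm.sin))
  refine (h.congr_deriv ?_).deriv
  simp only [gauTrig, eval_add, eval_sub, eval_mul, eval_C, eval_X, Pi.add_apply, Pi.mul_apply]
  ring

lemma contDiff_gauTrig (e m : ℝ) (P Q : Polynomial ℝ) (n : WithTop ℕ∞) :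
    ContDiff ℝ n (gauTrig e m P Q) := by
  have hP : ContDiff ℝ n fun x => P.eval x := by
    simpa using P.contDiff_aeval (𝕜 := ℝ) n
  have hQ : ContDiff ℝ n fun x => Q.eval x := by
    simpa using Q.contDiff_aeval (𝕜 := ℝ) n
  unfold gauTrig gau
  fun_prop

lemma iteratedDeriv_gauTrig (e m : ℝ) (n : ℕ) (P Q : Polynomial ℝ) :
    ∃ P' Q', iteratedDeriv n (gauTrig e m P Q) = gauTrig e m P' Q' := by
  induction n generalizing P Q with
  | zero => exact ⟨P, Q, iteratedDeriv_zero⟩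
  | succ n ih =>
    rw [iteratedDeriv_succ', deriv_gauTrig]
    exact ih _ _

/-- `gauTrig` as a Schwartz function. -/
noncomputable def gauTrigSchwartz {e : ℝ} (he : 0 < e) (m : ℝ) (P Q : Polynomial ℝ) :
    SchwartzMap ℝ ℝ where
  toFun := gauTrig e m P Q
  smooth' := contDiff_gauTrig e m P Q _
  decay' := by
    intro k n
    obtain ⟨P', Q', h⟩ := iteratedDeriv_gauTrig e m n P Q
    obtain ⟨C, hC⟩ := abs_eval_mul_gau_le he (Polynomial.X ^ k * P')
    obtain ⟨D, hD⟩ := abs_eval_mul_gau_le he (Polynomial.X ^ k * Q')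
    refine ⟨C + D, fun x => ?_⟩
    rw [norm_iteratedFDeriv_eq_norm_iteratedDeriv, h]
    have hx := hC x
    have hy := hD x
    have hg := gau_pos e x
    simp only [Polynomial.eval_mul, Polynomial.eval_pow, Polynomial.eval_X, abs_mul, abs_pow]
      at hx hy
    rw [Real.norm_eq_abs, Real.norm_eq_abs, gauTrig, abs_mul, abs_of_pos hg]
    have h1 : |P'.eval x * Real.cos (m * x) + Q'.eval x * Real.sin (m * x)|
        ≤ |P'.eval x| + |Q'.eval x| := by
      refine (abs_add_le _ _).trans (add_le_add ?_ ?_)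
      · rw [abs_mul]
        exact mul_le_of_le_one_right (abs_nonneg _) (Real.abs_cos_le_one _)
      · rw [abs_mul]
        exact mul_le_of_le_one_right (abs_nonneg _) (Real.abs_sin_le_one _)
    calc _ ≤ |x| ^ k * (gau e x * (|P'.eval x| + |Q'.eval x|)) := by gcongr
      _ ≤ C + D := by linarith

lemma hasDerivAt_abs_rpow_mul_self_s7 {p : ℝ} (hp : 1 < p) (x : ℝ) :
    HasDerivAt (fun t : ℝ => |t| ^ p * t) ((p + 1) * |x| ^ p) x := by
  refine ((hasDerivAt_abs_rpow x hp).mul (hasDerivAt_id x)).congr_deriv ?_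
  rcases eq_or_ne x 0 with rfl | hx
  · simp [Real.zero_rpow (by linarith : p ≠ 0)]
  · have h : |x| ^ p = |x| ^ (p - 2) * x ^ 2 := by
      rw [← sq_abs, ← Real.rpow_natCast, ← Real.rpow_add (abs_pos.2 hx)]
      norm_num
    simp only [id, h]
    ring

lemma continuous_abs_rpow {p : ℝ} (hp : 0 ≤ p) : Continuous fun t : ℝ => |t| ^ p :=
  continuous_abs.rpow_const fun _ => Or.inr hp

lemma abs_rpow_sub_abs_rpow_le {p : ℝ} (hp1 : 1 < p) (hp3 : p < 3) {s t : ℝ}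
    (hs : |s| ≤ 5) (ht : |t| ≤ 5) : |(|s| ^ p - |t| ^ p)| ≤ 75 * |s - t| := by
  have key := (convex_Icc (-5 : ℝ) 5).norm_image_sub_le_of_norm_hasDerivWithin_le
    (f := fun t : ℝ => |t| ^ p) (f' := fun x => p * |x| ^ (p - 2) * x) (C := 75)
    (fun x _ => (hasDerivAt_abs_rpow x hp1).hasDerivWithinAt) ?_
    (abs_le.1 ht) (abs_le.1 hs)
  · simpa using key
  · intro x hx
    have hx5 : |x| ≤ 5 := abs_le.2 hx
    rcases eq_or_ne x 0 with rfl | h0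
    · simp
    · have h : |x| ^ (p - 2) * |x| = |x| ^ (p - 1) := by
        rw [← Real.rpow_add_one (abs_pos.2 h0).ne']
        congr 1
        ring
      have h2 : |x| ^ (p - 1) ≤ 25 :=
        calc |x| ^ (p - 1) ≤ 5 ^ (p - 1) :=
              Real.rpow_le_rpow (abs_nonneg x) hx5 (by linarith)
          _ ≤ 5 ^ (2 : ℝ) := Real.rpow_le_rpow_of_exponent_le (by norm_num) (by linarith)
          _ = 25 := by norm_num
      have h3 : 0 ≤ |x| ^ (p - 1) := by positivity
      rw [Real.norm_eq_abs, abs_mul, abs_mul, abs_of_pos (by linarith : 0 < p),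
        abs_of_nonneg (by positivity : 0 ≤ |x| ^ (p - 2)), mul_assoc, h]
      nlinarith

lemma abs_rpow_mul_self_add_ge {p : ℝ} (hp1 : 1 < p) (hp3 : p < 3) {a b : ℝ}
    (h : |a| + |b| ≤ 5) :
    |a| ^ p * a + (p + 1) * |a| ^ p * b - 300 * b ^ 2 ≤ |a + b| ^ p * (a + b) := by
  have key := (convex_uIcc a (a + b)).norm_image_sub_le_of_norm_hasDerivWithin_le
    (f := fun t : ℝ => |t| ^ p * t - (p + 1) * |a| ^ p * t)
    (f' := fun x => (p + 1) * |x| ^ p - (p + 1) * |a| ^ p) (C := 300 * |b|)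
    (fun x _ => ?_) ?_ Set.left_mem_uIcc Set.right_mem_uIcc
  · rw [Real.norm_eq_abs, Real.norm_eq_abs, add_sub_cancel_left, mul_assoc 300, abs_mul_abs_self]
      at key
    have := (abs_le.1 key).1
    nlinarith
  · refine HasDerivAt.hasDerivWithinAt ((hasDerivAt_abs_rpow_mul_self_s7 hp1 x).sub ?_)
    simpa using (hasDerivAt_id x).const_mul ((p + 1) * |a| ^ p)
  · intro x hx
    have hxa : |x - a| ≤ |b| := by
      simpa using Set.abs_sub_left_of_mem_uIcc hx
    have hx5 : |x| ≤ 5 := by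
      have := abs_add_le a (x - a)
      rw [add_sub_cancel] at this
      linarith
    have := abs_rpow_sub_abs_rpow_le hp1 hp3 hx5 (t := a) (by linarith [abs_nonneg b])
    rw [← mul_sub, Real.norm_eq_abs, abs_mul, abs_of_pos (by linarith : 0 < p + 1)]
    nlinarith [abs_nonneg (|x| ^ p - |a| ^ p), abs_nonneg (x - a)]

lemma gau_eq_sq (e x : ℝ) : gau e x = Real.exp (-((e * x) ^ 2 / 2)) ^ 2 := by
  rw [gau, ← Real.exp_nat_mul]
  congr 1
  push_cast
  ring

lemma one_add_mul_exp_neg_le_one (t : ℝ) : (1 + t) * Real.exp (-t) ≤ 1 := by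
  have h := Real.add_one_le_exp t
  have h2 : Real.exp t * Real.exp (-t) = 1 := by rw [← Real.exp_add]; simp
  nlinarith [Real.exp_pos (-t)]

lemma abs_gau_slope_le {e : ℝ} (he : 0 < e) (x : ℝ) :
    |2 * e ^ 2 * x * gau e x| ≤ 2 * e * Real.exp (-((e * x) ^ 2 / 2)) := by
  have h := one_add_mul_exp_neg_le_one ((e * x) ^ 2 / 2)
  rw [gau_eq_sq]
  set s := Real.exp (-((e * x) ^ 2 / 2))
  have hs : 0 < s := Real.exp_pos _
  have h1 : |e * x| * s ≤ 1 := by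
    have : |e * x| ≤ 1 + (e * x) ^ 2 / 2 := by
      rw [← sq_abs]; nlinarith [sq_nonneg (|e * x| - 1)]
    nlinarith
  have h2 : |2 * e ^ 2 * x * s ^ 2| = 2 * e * s * (|e * x| * s) := by
    rw [show 2 * e ^ 2 * x * s ^ 2 = (2 * e * s ^ 2) * (e * x) by ring, abs_mul,
      abs_of_pos (by positivity)]
    ring
  rw [h2]
  exact mul_le_of_le_one_right (by positivity) h1

lemma abs_gau_curv_le {e : ℝ} (he : 0 < e) (he1 : e ≤ 1) (x : ℝ) :
    |(4 * e ^ 4 * x ^ 2 - 2 * e ^ 2) * gau e x| ≤ 10 * e * Real.exp (-((e * x) ^ 2 / 2)) := by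
  have h := one_add_mul_exp_neg_le_one ((e * x) ^ 2 / 2)
  have h0 : Real.exp (-((e * x) ^ 2 / 2)) ≤ 1 := by
    rw [Real.exp_le_one_iff]; nlinarith [sq_nonneg (e * x)]
  rw [gau_eq_sq]
  set s := Real.exp (-((e * x) ^ 2 / 2))
  have hs : 0 < s := Real.exp_pos _
  have h1 : |(4 * (e * x) ^ 2 - 2) * s| ≤ 10 := by
    rw [abs_le]; constructor <;> nlinarith [mul_nonneg (sq_nonneg (e * x)) hs.le]
  rw [show (4 * e ^ 4 * x ^ 2 - 2 * e ^ 2) * s ^ 2 =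
    (e * e * s) * ((4 * (e * x) ^ 2 - 2) * s) by ring, abs_mul,
    abs_of_pos (by positivity : 0 < e * e * s)]
  have h2 : e * e * s ≤ e * s := by nlinarith [mul_pos he hs]
  nlinarith [abs_nonneg ((4 * (e * x) ^ 2 - 2) * s), mul_pos he hs]

lemma abs_mul_le_of_abs_le_one {a t c : ℝ} (ha : |a| ≤ c) (ht : |t| ≤ 1) : |a * t| ≤ c := by
  rw [abs_mul]
  exact (mul_le_of_le_one_right (abs_nonneg a) ht).trans ha

/-- The trial function: a slowly modulated `cos x` with a second harmonic of relative size `d`. -/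
noncomputable def trial (e d x : ℝ) : ℝ :=
  -(gau e x * Real.cos x) - d / 2 * (gau e x * Real.sin (2 * x))

/-- The part of the derivative of `trial` besides `gau e x * sin x`. -/
noncomputable def trialRest (e d x : ℝ) : ℝ :=
  2 * e ^ 2 * x * gau e x * Real.cos x
    + d * (e ^ 2 * x * gau e x * Real.sin (2 * x) - gau e x * Real.cos (2 * x))

noncomputable def trialDeriv (e d x : ℝ) : ℝ := gau e x * Real.sin x + trialRest e d x

/-- `trial'' + trial`. -/
noncomputable def trialResidual (e d x : ℝ) : ℝ :=
  -((4 * e ^ 4 * x ^ 2 - 2 * e ^ 2) * gau e x * Real.cos x)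
    - 2 * (2 * e ^ 2 * x * gau e x * Real.sin x)
    - d / 2 * ((4 * e ^ 4 * x ^ 2 - 2 * e ^ 2) * gau e x * Real.sin (2 * x)
      - 4 * (2 * e ^ 2 * x * gau e x * Real.cos (2 * x)) - 3 * (gau e x * Real.sin (2 * x)))

lemma hasDerivAt_two_mul (x : ℝ) : HasDerivAt (fun x : ℝ => 2 * x) 2 x := by
  simpa using (hasDerivAt_id x).const_mul 2

lemma hasDerivAt_trial (e d x : ℝ) : HasDerivAt (trial e d) (trialDeriv e d x) x := by
  have hg := hasDerivAt_gau e x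
  refine ((hg.mul (Real.hasDerivAt_cos x)).neg.sub
    ((hg.mul (hasDerivAt_two_mul x).sin).const_mul (d / 2))).congr_deriv ?_
  simp only [trialDeriv, trialRest]
  ring

lemma hasDerivAt_trialDeriv (e d x : ℝ) :
    HasDerivAt (trialDeriv e d) (trialResidual e d x - trial e d x) x := by
  have hg := hasDerivAt_gau e x
  have h1 := ((hasDerivAt_id x).const_mul (2 * e ^ 2)).mul hg
  have h2 := ((hasDerivAt_id x).const_mul (e ^ 2)).mul hg
  have h := (hg.mul (Real.hasDerivAt_sin x)).add
    ((h1.mul (Real.hasDerivAt_cos x)).add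
      (((h2.mul (hasDerivAt_two_mul x).sin).sub (hg.mul (hasDerivAt_two_mul x).cos)).const_mul d))
  refine h.congr_deriv ?_
  simp only [trialResidual, trial, id, Pi.mul_apply]
  ring

section
variable {e d : ℝ} (he : 0 < e) (he1 : e ≤ 1) (hd : 0 < d) (hd1 : d ≤ 1) (x : ℝ)
include he he1 hd

lemma abs_trialResidual_le :
    |trialResidual e d x| ≤ 14 * (e + d) * Real.exp (-((e * x) ^ 2 / 2)) := by
  have h0 : Real.exp (-((e * x) ^ 2 / 2)) ≤ 1 := by
    rw [Real.exp_le_one_iff]; nlinarith [sq_nonneg (e * x)]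
  have hg : |gau e x| ≤ Real.exp (-((e * x) ^ 2 / 2)) := by
    rw [abs_of_pos (gau_pos e x), gau_eq_sq]
    nlinarith [Real.exp_pos (-((e * x) ^ 2 / 2))]
  have h1 := abs_gau_slope_le he x
  have h2 := abs_gau_curv_le he he1 x
  unfold trialResidual
  have a1 := abs_le.1 (abs_mul_le_of_abs_le_one h2 (Real.abs_cos_le_one x))
  have a2 := abs_le.1 (abs_mul_le_of_abs_le_one h1 (Real.abs_sin_le_one x))
  have a3 := abs_le.1 (abs_mul_le_of_abs_le_one h2 (Real.abs_sin_le_one (2 * x)))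
  have a4 := abs_le.1 (abs_mul_le_of_abs_le_one h1 (Real.abs_cos_le_one (2 * x)))
  have a5 := abs_le.1 (abs_mul_le_of_abs_le_one hg (Real.abs_sin_le_one (2 * x)))
  set s := Real.exp (-((e * x) ^ 2 / 2))
  have hs : 0 < s := Real.exp_pos _
  have hes : e * s ≤ s := by nlinarith
  have h3 : |(4 * e ^ 4 * x ^ 2 - 2 * e ^ 2) * gau e x * Real.sin (2 * x)
      - 4 * (2 * e ^ 2 * x * gau e x * Real.cos (2 * x)) - 3 * (gau e x * Real.sin (2 * x))|
      ≤ 28 * s := by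
    rw [abs_le]; constructor <;> linarith
  have h4 := abs_le.1 h3
  rw [abs_le]; constructor <;> nlinarith

lemma abs_trialRest_le :
    |trialRest e d x| ≤ 2 * (e + d) * Real.exp (-((e * x) ^ 2 / 2)) := by
  have h0 : Real.exp (-((e * x) ^ 2 / 2)) ≤ 1 := by
    rw [Real.exp_le_one_iff]; nlinarith [sq_nonneg (e * x)]
  have hg : |gau e x| ≤ Real.exp (-((e * x) ^ 2 / 2)) := by
    rw [abs_of_pos (gau_pos e x), gau_eq_sq]
    nlinarith [Real.exp_pos (-((e * x) ^ 2 / 2))]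
  have h1 := abs_gau_slope_le he x
  have a1 := abs_le.1 (abs_mul_le_of_abs_le_one h1 (Real.abs_cos_le_one x))
  have a2 := abs_le.1 (abs_mul_le_of_abs_le_one h1 (Real.abs_sin_le_one (2 * x)))
  have a3 := abs_le.1 (abs_mul_le_of_abs_le_one hg (Real.abs_cos_le_one (2 * x)))
  unfold trialRest
  set s := Real.exp (-((e * x) ^ 2 / 2))
  have hs : 0 < s := Real.exp_pos _
  have hes : e * s ≤ s := by nlinarith
  have h3 : |e ^ 2 * x * gau e x * Real.sin (2 * x) - gau e x * Real.cos (2 * x)| ≤ 2 * s := by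
    rw [abs_le]; constructor <;> linarith
  have h4 := abs_le.1 h3
  rw [abs_le]; constructor <;> nlinarith

include hd1

lemma abs_trialDeriv_le :
    |gau e x * Real.sin x| + |trialRest e d x| ≤ 5 * Real.exp (-((e * x) ^ 2 / 2)) := by
  have h0 : Real.exp (-((e * x) ^ 2 / 2)) ≤ 1 := by
    rw [Real.exp_le_one_iff]; nlinarith [sq_nonneg (e * x)]
  have hg : |gau e x| ≤ Real.exp (-((e * x) ^ 2 / 2)) := by
    rw [abs_of_pos (gau_pos e x), gau_eq_sq]
    nlinarith [Real.exp_pos (-((e * x) ^ 2 / 2))]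
  have h1 := abs_mul_le_of_abs_le_one hg (Real.abs_sin_le_one x)
  have h2 := abs_trialRest_le he he1 hd x
  nlinarith [Real.exp_pos (-((e * x) ^ 2 / 2))]

end

/-- A bounded primitive absorbing the oscillating part of the interaction term. -/
noncomputable def corrector (p e x : ℝ) : ℝ :=
  gau (e * Real.sqrt (p + 1)) x * (2 / (p + 2) * (|Real.sin x| ^ p * Real.sin x * Real.cos x)
    + p / (p + 2) / 4 * Real.sin (2 * x))

noncomputable def correctorDeriv (p e x : ℝ) : ℝ :=
  -(2 * (p + 1) * (e ^ 2 * x * gau (e * Real.sqrt (p + 1)) x)) *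
      (2 / (p + 2) * (|Real.sin x| ^ p * Real.sin x * Real.cos x)
        + p / (p + 2) / 4 * Real.sin (2 * x))
    + gau (e * Real.sqrt (p + 1)) x *
      (2 / (p + 2) * (|Real.sin x| ^ p * ((p + 1) - (p + 2) * Real.sin x ^ 2))
        + p / (p + 2) / 2 * Real.cos (2 * x))

lemma hasDerivAt_corrector {p : ℝ} (hp : 1 < p) (e x : ℝ) :
    HasDerivAt (corrector p e) (correctorDeriv p e x) x := by
  have hK := ((hasDerivAt_abs_rpow_mul_self_s7 hp (Real.sin x)).comp x (Real.hasDerivAt_sin x)).mul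
    (Real.hasDerivAt_cos x)
  refine ((hasDerivAt_gau (e * Real.sqrt (p + 1)) x).mul ((hK.const_mul (2 / (p + 2))).add
    ((hasDerivAt_two_mul x).sin.const_mul (p / (p + 2) / 4)))).congr_deriv ?_
  simp only [correctorDeriv, Pi.add_apply, Pi.mul_apply, Function.comp, mul_pow,
    Real.sq_sqrt (by linarith : 0 ≤ p + 1)]
  have h := Real.cos_sq' x
  linear_combination (gau (e * Real.sqrt (p + 1)) x * (2 / (p + 2)) * |Real.sin x| ^ p * (p + 1)) * h

lemma gau_rpow_mul_gau {p : ℝ} (hp : 1 < p) (e x : ℝ) :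
    gau e x ^ p * gau e x = gau (e * Real.sqrt (p + 1)) x := by
  simp only [gau, ← Real.exp_mul, ← Real.exp_add, mul_pow, Real.sq_sqrt (by linarith : 0 ≤ p + 1)]
  congr 1
  ring

lemma abs_slope_gau_sqrt_le {p : ℝ} (hp : 1 < p) {e : ℝ} (he : 0 < e) (x : ℝ) :
    |e ^ 2 * x * gau (e * Real.sqrt (p + 1)) x| ≤ e * gau e x := by
  have h1 : gau (e * Real.sqrt (p + 1)) x ≤ gau e x * gau e x := by
    simp only [gau, ← Real.exp_add, mul_pow, Real.sq_sqrt (by linarith : 0 ≤ p + 1)]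
    apply Real.exp_le_exp.2
    nlinarith [mul_nonneg (sq_nonneg e) (sq_nonneg x)]
  have h2 := abs_gau_slope_le he x
  have h3 : Real.exp (-((e * x) ^ 2 / 2)) ≤ 1 := by
    rw [Real.exp_le_one_iff]; nlinarith [sq_nonneg (e * x)]
  have hg := gau_pos e x
  rw [abs_mul, abs_of_pos (gau_pos _ x)]
  rw [mul_assoc 2, mul_assoc 2, abs_mul, abs_mul, abs_of_pos hg] at h2
  norm_num at h2
  calc |e ^ 2 * x| * gau (e * Real.sqrt (p + 1)) x ≤ |e ^ 2 * x| * (gau e x * gau e x) := by gcongr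
    _ ≤ e * gau e x := by
      have : |e ^ 2 * x| * gau e x ≤ e := by
        rw [abs_mul, abs_of_pos (by positivity : 0 < e ^ 2)]
        nlinarith
      nlinarith

lemma interaction_ge {p : ℝ} (hp1 : 1 < p) (hp3 : p < 3) {e : ℝ} (he : 0 < e) (x : ℝ) :
    gau (e * Real.sqrt (p + 1)) x / 12 - 16 * e * gau e x - correctorDeriv p e x ≤
      |gau e x * Real.sin x| ^ p *
        (e ^ 2 * x * gau e x * Real.sin (2 * x) - gau e x * Real.cos (2 * x)) := by
  have hf := gau_rpow_mul_gau hp1 e x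
  have hb := abs_slope_gau_sqrt_le hp1 he x
  have hf0 := gau_pos (e * Real.sqrt (p + 1)) x
  have hg0 := gau_pos e x
  have hs1 := Real.abs_sin_le_one x
  have hw1 : |Real.sin x| ^ p ≤ 1 := Real.rpow_le_one (abs_nonneg _) hs1 (by linarith)
  have hw0 : 0 ≤ |Real.sin x| ^ p := by positivity
  have hw : Real.sin x ^ 2 - 1 / 4 ≤ |Real.sin x| ^ p := by
    have : |Real.sin x| ^ (4 : ℝ) ≤ |Real.sin x| ^ p :=
      Real.rpow_le_rpow_of_exponent_ge' (abs_nonneg _) hs1 (by linarith) (by linarith)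
    have h4 : |Real.sin x| ^ (4 : ℝ) = (Real.sin x ^ 2) ^ 2 := by
      rw [← sq_abs (Real.sin x), ← pow_mul]; norm_cast
    nlinarith [sq_nonneg (Real.sin x ^ 2 - 1 / 2)]
  have hsc : |Real.sin x * Real.cos x| ≤ 1 :=
    abs_mul_le_of_abs_le_one hs1 (Real.abs_cos_le_one x)
  rw [abs_mul, abs_of_pos hg0, Real.mul_rpow hg0.le (abs_nonneg _)]
  have e1 : gau e x ^ p * |Real.sin x| ^ p *
        (e ^ 2 * x * gau e x * Real.sin (2 * x) - gau e x * Real.cos (2 * x)) =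
      gau (e * Real.sqrt (p + 1)) x * |Real.sin x| ^ p *
        (e ^ 2 * x * Real.sin (2 * x) - Real.cos (2 * x)) := by
    rw [← hf]; ring
  rw [e1, correctorDeriv, Real.sin_two_mul, Real.cos_two_mul, Real.cos_sq']
  obtain ⟨r, hr⟩ : ∃ r, r = p / (p + 2) := ⟨_, rfl⟩
  have hr1 : 1 / 3 ≤ r := by rw [hr, div_le_div_iff₀] <;> linarith
  have hr2 : r ≤ 1 := by rw [hr, div_le_one] <;> linarith
  have hpr : p = r * (p + 2) := by rw [hr]; field_simp
  have hr3 : 2 / (p + 2) = 1 - r := by rw [hr]; field_simp; ring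
  rw [← hr, hr3]
  generalize gau (e * Real.sqrt (p + 1)) x = f at *
  generalize |Real.sin x| ^ p = w at *
  generalize Real.sin x = s at *
  generalize Real.cos x = c at *
  have hB : |e ^ 2 * x * f * (s * c)| ≤ e * gau e x := abs_mul_le_of_abs_le_one hb hsc
  have hC : |2 * r * w + p * (1 + r) / 2| ≤ 5 := by
    rw [abs_le]; constructor <;> nlinarith
  have hBC : e ^ 2 * x * f * (s * c) * (2 * r * w + p * (1 + r) / 2) ≤ (e * gau e x) * 5 := by
    refine (le_abs_self _).trans ?_
    rw [abs_mul]
    gcongr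
  have hE : 0 < e * gau e x := by positivity
  have hm : 0 ≤ f * (r * (w - (s ^ 2 - 1 / 4))) :=
    mul_nonneg hf0.le (mul_nonneg (by linarith) (by linarith))
  have hm2 : 0 ≤ f * (r - 1 / 3) := mul_nonneg hf0.le (by linarith)
  have key : f * w * (e ^ 2 * x * (2 * s * c) - (2 * (1 - s ^ 2) - 1)) -
      (f / 12 - 16 * e * gau e x -
        (-(2 * (p + 1) * (e ^ 2 * x * f)) * ((1 - r) * (w * s * c) + r / 4 * (2 * s * c)) +
          f * ((1 - r) * (w * (p + 1 - (p + 2) * s ^ 2)) + r / 2 * (2 * (1 - s ^ 2) - 1)))) =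
      f * (r * (w - (s ^ 2 - 1 / 4))) + f * (r - 1 / 3) / 4 + 16 * (e * gau e x)
        - e ^ 2 * x * f * (s * c) * (2 * r * w + p * (1 + r) / 2) := by
    linear_combination (f * w - f * w * s ^ 2 - 2 * (e ^ 2 * x * f) * w * s * c
      + e ^ 2 * x * f * s * c / 2) * hpr
  linarith

section
variable {e d : ℝ} (he : 0 < e) (he1 : e ≤ 1) (hd : 0 < d) (hd1 : d ≤ 1)
include he he1 hd hd1

lemma power_trialDeriv_ge {p : ℝ} (hp1 : 1 < p) (hp3 : p < 3) (x : ℝ) :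
    (|gau e x * Real.sin x| ^ p * (gau e x * Real.sin x)
      + (p + 1) * (|gau e x * Real.sin x| ^ p * (2 * e ^ 2 * x * gau e x * Real.cos x)))
      + ((p + 1) * d * (gau (e * Real.sqrt (p + 1)) x / 12 - 16 * e * gau e x
        - correctorDeriv p e x) - 1200 * (e + d) ^ 2 * gau e x) ≤
      |trialDeriv e d x| ^ p * trialDeriv e d x := by
  have h1 := abs_trialDeriv_le he he1 hd hd1 x
  have h0 : Real.exp (-((e * x) ^ 2 / 2)) ≤ 1 := by
    rw [Real.exp_le_one_iff]; nlinarith [sq_nonneg (e * x)]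
  have h2 := abs_rpow_mul_self_add_ge hp1 hp3 (h1.trans (by linarith))
  have h3 : trialRest e d x ^ 2 ≤ 4 * (e + d) ^ 2 * gau e x := by
    rw [gau_eq_sq, ← sq_abs]
    calc _ ≤ (2 * (e + d) * Real.exp (-((e * x) ^ 2 / 2))) ^ 2 := by
          gcongr; exact abs_trialRest_le he he1 hd x
      _ = _ := by ring
  have h4 := mul_le_mul_of_nonneg_left (interaction_ge hp1 hp3 he x)
    (by positivity : 0 ≤ (p + 1) * d)
  rw [trialDeriv]
  unfold trialRest at h2 h3 ⊢
  nlinarith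

end

lemma integrable_of_abs_le_gau {e C : ℝ} (he : 0 < e) {h : ℝ → ℝ} (hc : Continuous h)
    (hb : ∀ x, |h x| ≤ C * gau e x) : Integrable h :=
  ((integrable_gau he).const_mul C).mono' hc.aestronglyMeasurable
    (Filter.Eventually.of_forall hb)

lemma integral_eq_zero_of_neg_eq_neg {h : ℝ → ℝ} (hodd : ∀ x, h (-x) = -h x) :
    ∫ x, h x = 0 := by
  have h1 := integral_neg_eq_self h volume
  simp only [hodd, integral_neg] at h1
  linarith

lemma continuous_trialDeriv (e d : ℝ) : Continuous (trialDeriv e d) :=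
  continuous_iff_continuousAt.2 fun x => (hasDerivAt_trialDeriv e d x).continuousAt

lemma continuous_trialResidual (e d : ℝ) : Continuous (trialResidual e d) := by
  unfold trialResidual gau; fun_prop

lemma abs_rpow_le_of_abs_le {p t s C : ℝ} (hp : 1 < p) (hp3 : p < 3) (hs : 0 ≤ s) (hs1 : s ≤ 1)
    (ht : |t| ≤ C * s) (hC : 1 ≤ C) : |t| ^ p ≤ C ^ 3 * s := by
  calc |t| ^ p ≤ (C * s) ^ p := Real.rpow_le_rpow (abs_nonneg _) ht (by linarith)
    _ = C ^ p * s ^ p := Real.mul_rpow (by linarith) hs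
    _ ≤ C ^ (3 : ℝ) * s ^ (1 : ℝ) := by
      gcongr ?_ * ?_
      · exact Real.rpow_le_rpow_of_exponent_le hC hp3.le
      · exact Real.rpow_le_rpow_of_exponent_ge' hs hs1 (by norm_num) hp.le
    _ = C ^ 3 * s := by norm_cast; simp

section
variable {p : ℝ} (hp1 : 1 < p) (hp3 : p < 3) {e : ℝ} (he : 0 < e)
include hp1 he

lemma integrable_gau_sqrt : Integrable (gau (e * Real.sqrt (p + 1))) :=
  integrable_gau (mul_pos he (Real.sqrt_pos.2 (by linarith)))

omit he in
lemma gau_sqrt_le (x : ℝ) : gau (e * Real.sqrt (p + 1)) x ≤ gau e x := by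
  simp only [gau, mul_pow, Real.sq_sqrt (by linarith : 0 ≤ p + 1)]
  apply Real.exp_le_exp.2
  nlinarith [mul_nonneg (sq_nonneg e) (sq_nonneg x)]

omit he in
lemma abs_profile_le (x : ℝ) :
    |2 / (p + 2) * (|Real.sin x| ^ p * Real.sin x * Real.cos x)
      + p / (p + 2) / 4 * Real.sin (2 * x)| ≤ 2 := by
  have hr1 : p / (p + 2) ≤ 1 := by rw [div_le_one] <;> linarith
  have hr0 : 0 ≤ p / (p + 2) := by positivity
  have hq1 : 2 / (p + 2) ≤ 1 := by rw [div_le_one] <;> linarith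
  have hq0 : 0 ≤ 2 / (p + 2) := by positivity
  have hs1 := Real.abs_sin_le_one x
  have hw1 : |Real.sin x| ^ p ≤ 1 := Real.rpow_le_one (abs_nonneg _) hs1 (by linarith)
  have hw0 : 0 ≤ |Real.sin x| ^ p := by positivity
  have h1 : |(|Real.sin x| ^ p * Real.sin x * Real.cos x)| ≤ 1 :=
    abs_mul_le_of_abs_le_one (abs_mul_le_of_abs_le_one (by rwa [abs_of_nonneg hw0]) hs1)
      (Real.abs_cos_le_one x)
  have h2 := abs_mul_le_of_abs_le_one (abs_of_nonneg hq0 ▸ hq1) h1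
  have h3 := abs_mul_le_of_abs_le_one (a := p / (p + 2) / 4) (c := 1)
    (by rw [abs_of_nonneg (by positivity)]; linarith) (Real.abs_sin_le_one (2 * x))
  exact (abs_add_le _ _).trans (by linarith)

lemma integrable_corrector : Integrable (corrector p e) := by
  have hc : Continuous (corrector p e) :=
    continuous_iff_continuousAt.2 fun x => (hasDerivAt_corrector hp1 e x).continuousAt
  refine integrable_of_abs_le_gau (C := 2) he hc fun x => ?_
  rw [corrector, abs_mul, abs_of_pos (gau_pos _ _), mul_comm]
  have := abs_profile_le hp1 x
  exact mul_le_mul this (gau_sqrt_le hp1 x) (gau_pos _ _).le (by norm_num)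

include hp3

lemma integrable_correctorDeriv : Integrable (correctorDeriv p e) := by
  have hc : Continuous (correctorDeriv p e) := by
    have h1 : Continuous fun x => |Real.sin x| ^ p :=
      (continuous_abs_rpow (by linarith)).comp Real.continuous_sin
    have h2 := continuous_gau (e * Real.sqrt (p + 1))
    unfold correctorDeriv
    fun_prop
  refine integrable_of_abs_le_gau (C := 16 * e + 10) he hc fun x => ?_
  have hb := abs_slope_gau_sqrt_le hp1 he x
  have hP := abs_profile_le hp1 x
  have hs1 := Real.abs_sin_le_one x
  have hw1 : |Real.sin x| ^ p ≤ 1 := Real.rpow_le_one (abs_nonneg _) hs1 (by linarith)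
  have hw0 : 0 ≤ |Real.sin x| ^ p := by positivity
  have hr1 : p / (p + 2) ≤ 1 := by rw [div_le_one] <;> linarith
  have hr0 : 0 ≤ p / (p + 2) := by positivity
  have hq1 : 2 / (p + 2) ≤ 1 := by rw [div_le_one] <;> linarith
  have hq0 : 0 ≤ 2 / (p + 2) := by positivity
  have hss : Real.sin x ^ 2 ≤ 1 := by
    rw [← sq_abs]; nlinarith [abs_nonneg (Real.sin x)]
  have h5 : |(p + 1) - (p + 2) * Real.sin x ^ 2| ≤ 9 := by
    rw [abs_le]; constructor <;> nlinarith [sq_nonneg (Real.sin x)]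
  have h6 : |(p + 1 - (p + 2) * Real.sin x ^ 2) * |Real.sin x| ^ p * (2 / (p + 2))| ≤ 9 :=
    abs_mul_le_of_abs_le_one (abs_mul_le_of_abs_le_one h5 (by rwa [abs_of_nonneg hw0]))
      (by rwa [abs_of_nonneg hq0])
  have h7 := abs_mul_le_of_abs_le_one (a := p / (p + 2) / 2) (c := 1)
    (by rw [abs_of_nonneg (by positivity)]; linarith) (Real.abs_cos_le_one (2 * x))
  have h8 : |2 / (p + 2) * (|Real.sin x| ^ p * ((p + 1) - (p + 2) * Real.sin x ^ 2))
        + p / (p + 2) / 2 * Real.cos (2 * x)| ≤ 10 := by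
    refine (abs_add_le _ _).trans ?_
    rw [show 2 / (p + 2) * (|Real.sin x| ^ p * ((p + 1) - (p + 2) * Real.sin x ^ 2)) =
      (p + 1 - (p + 2) * Real.sin x ^ 2) * |Real.sin x| ^ p * (2 / (p + 2)) by ring]
    linarith
  refine (abs_add_le _ _).trans ?_
  rw [abs_mul, abs_mul (gau _ _), abs_neg, abs_mul (2 * (p + 1)), abs_of_pos (gau_pos _ _),
    abs_of_pos (by linarith : 0 < 2 * (p + 1))]
  have h9 : 2 * (p + 1) * |e ^ 2 * x * gau (e * Real.sqrt (p + 1)) x| ≤ 8 * (e * gau e x) :=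
    mul_le_mul (by linarith) hb (abs_nonneg _) (by norm_num)
  have h10 := mul_le_mul h9 hP (abs_nonneg _) (by have := gau_pos e x; positivity)
  have h11 := mul_le_mul (gau_sqrt_le hp1 x) h8 (abs_nonneg _) (gau_pos e x).le
  linarith

lemma integral_correctorDeriv : ∫ x, correctorDeriv p e x = 0 :=
  integral_eq_zero_of_hasDerivAt_of_integrable (hasDerivAt_corrector hp1 e)
    (integrable_correctorDeriv hp1 hp3 he) (integrable_corrector hp1 he)

lemma integrable_oddPart : Integrable fun x => |gau e x * Real.sin x| ^ p * (gau e x * Real.sin x)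
      + (p + 1) * (|gau e x * Real.sin x| ^ p * (2 * e ^ 2 * x * gau e x * Real.cos x)) := by
  refine integrable_of_abs_le_gau (C := 1 + 8 * e) he ?_ fun x => ?_
  · have h2 := continuous_gau e
    have h1 : Continuous fun x => |gau e x * Real.sin x| ^ p :=
      (continuous_abs_rpow (by linarith)).comp (h2.mul Real.continuous_sin)
    fun_prop
  · have hg0 := gau_pos e x
    have hg1 : gau e x ≤ 1 := by
      rw [gau, Real.exp_le_one_iff]; nlinarith [mul_nonneg (sq_nonneg e) (sq_nonneg x)]
    have ha : |gau e x * Real.sin x| ≤ gau e x :=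
      abs_mul_le_of_abs_le_one (abs_of_pos hg0).le (Real.abs_sin_le_one x)
    have hw0 : 0 ≤ |gau e x * Real.sin x| ^ p := by positivity
    have hw : |gau e x * Real.sin x| ^ p ≤ gau e x := by
      simpa only [one_pow, one_mul] using
        abs_rpow_le_of_abs_le hp1 hp3 hg0.le hg1 (C := 1) (by rwa [one_mul]) le_rfl
    have h0 : Real.exp (-((e * x) ^ 2 / 2)) ≤ 1 := by
      rw [Real.exp_le_one_iff]; nlinarith [sq_nonneg (e * x)]
    have h1 := abs_mul_le_of_abs_le_one (abs_gau_slope_le he x) (Real.abs_cos_le_one x)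
    have h2 : |2 * e ^ 2 * x * gau e x * Real.cos x| ≤ 2 * e := by nlinarith
    refine (abs_add_le _ _).trans ?_
    rw [abs_mul, abs_mul (p + 1), abs_mul (|gau e x * Real.sin x| ^ p), abs_of_nonneg hw0,
      abs_of_pos (by linarith : 0 < p + 1)]
    have h3 := mul_le_mul hw (ha.trans hg1) (abs_nonneg _) hg0.le
    have h4 := mul_le_mul hw h2 (abs_nonneg _) hg0.le
    have h5 := mul_le_mul (by linarith : p + 1 ≤ 4) h4 (by positivity) (by norm_num)
    linarith

variable (he1 : e ≤ 1) {d : ℝ} (hd : 0 < d) (hd1 : d ≤ 1)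
include he1 hd hd1

lemma integrable_power_trialDeriv :
    Integrable fun x => |trialDeriv e d x| ^ p * trialDeriv e d x := by
  refine integrable_of_abs_le_gau (C := 5 ^ 3 * 5) he ?_ fun x => ?_
  · exact ((continuous_abs_rpow (by linarith)).comp (continuous_trialDeriv e d)).mul
      (continuous_trialDeriv e d)
  · have h0 : Real.exp (-((e * x) ^ 2 / 2)) ≤ 1 := by
      rw [Real.exp_le_one_iff]; nlinarith [sq_nonneg (e * x)]
    have h1 := (abs_add_le _ _).trans (abs_trialDeriv_le he he1 hd hd1 x)
    have h2 := abs_rpow_le_of_abs_le hp1 hp3 (Real.exp_pos _).le h0 h1 (by norm_num)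
    have h3 := mul_le_mul h2 h1 (abs_nonneg _) (by positivity)
    rw [trialDeriv, abs_mul, abs_of_nonneg (by positivity), gau_eq_sq e x]
    rw [gau_eq_sq e x] at h3
    linarith

lemma integral_power_trialDeriv_ge :
    (p + 1) * (Real.sqrt Real.pi / e * (d * (1 / 24 - 16 * e) - 600 * (e + d) ^ 2)) ≤
      ∫ x, |trialDeriv e d x| ^ p * trialDeriv e d x := by
  have i1 := integrable_oddPart hp1 hp3 he
  have i2 := ((integrable_gau_sqrt hp1 he).div_const 12).sub ((integrable_gau he).const_mul (16 * e))
  have i3 := (i2.sub (integrable_correctorDeriv hp1 hp3 he)).const_mul ((p + 1) * d)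
  have i4 := i3.sub ((integrable_gau he).const_mul (1200 * (e + d) ^ 2))
  have h := integral_mono (i1.add i4) (integrable_power_trialDeriv hp1 hp3 he he1 hd hd1)
    (fun x => power_trialDeriv_ge he he1 hd hd1 hp1 hp3 x)
  rw [integral_add' i1 i4, integral_eq_zero_of_neg_eq_neg, zero_add,
    integral_sub' i3 ((integrable_gau he).const_mul (1200 * (e + d) ^ 2)),
    integral_const_mul, integral_const_mul, integral_sub' i2 (integrable_correctorDeriv hp1 hp3 he),
    integral_correctorDeriv hp1 hp3 he, integral_sub' ((integrable_gau_sqrt hp1 he).div_const 12)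
      ((integrable_gau he).const_mul (16 * e)), integral_const_mul, integral_div,
    integral_gau he, integral_gau (mul_pos he (Real.sqrt_pos.2 (by linarith)))] at h
  · refine le_trans ?_ h
    have hq : Real.sqrt (p + 1) ≤ 2 := by
      rw [Real.sqrt_le_left (by norm_num)]; linarith
    have hq0 : 0 < Real.sqrt (p + 1) := Real.sqrt_pos.2 (by linarith)
    have hJ : Real.sqrt Real.pi / e / 2 ≤ Real.sqrt Real.pi / (e * Real.sqrt (p + 1)) := by
      rw [← div_div (Real.sqrt Real.pi)]
      exact div_le_div_of_nonneg_left (by positivity) hq0 hq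
    have hJ0 : 0 ≤ Real.sqrt Real.pi / e := by positivity
    have hpd : 0 ≤ (p + 1) * d := by positivity
    have h5 := mul_le_mul_of_nonneg_left hJ hpd
    have h6 : 0 ≤ (p - 1) * (600 * (e + d) ^ 2 * (Real.sqrt Real.pi / e)) :=
      mul_nonneg (by linarith) (by positivity)
    linarith
  · intro x
    have : gau e (-x) = gau e x := by simp [gau]
    simp only [this, Real.sin_neg, Real.cos_neg, mul_neg, abs_neg, neg_mul]
    ring

end

section
variable {e d : ℝ} (he : 0 < e) (he1 : e ≤ 1) (hd : 0 < d) (hd1 : d ≤ 1)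
include he he1 hd hd1

lemma abs_trialDeriv_le' (x : ℝ) : |trialDeriv e d x| ≤ 5 * Real.exp (-((e * x) ^ 2 / 2)) :=
  (abs_add_le _ _).trans (abs_trialDeriv_le he he1 hd hd1 x)

omit he he1 in
lemma abs_trial_le (x : ℝ) : |trial e d x| ≤ 2 * Real.exp (-((e * x) ^ 2 / 2)) := by
  have h0 : Real.exp (-((e * x) ^ 2 / 2)) ≤ 1 := by
    rw [Real.exp_le_one_iff]; nlinarith [sq_nonneg (e * x)]
  have hg : |gau e x| ≤ Real.exp (-((e * x) ^ 2 / 2)) := by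
    rw [abs_of_pos (gau_pos e x), gau_eq_sq]
    nlinarith [Real.exp_pos (-((e * x) ^ 2 / 2))]
  have a1 := abs_le.1 (abs_mul_le_of_abs_le_one hg (Real.abs_cos_le_one x))
  have h2 := abs_mul_le_of_abs_le_one hg (Real.abs_sin_le_one (2 * x))
  have h3 : d / 2 * |gau e x * Real.sin (2 * x)| ≤ 1 * Real.exp (-((e * x) ^ 2 / 2)) :=
    mul_le_mul (by linarith) h2 (abs_nonneg _) (by norm_num)
  rw [← abs_of_pos (by positivity : 0 < d / 2), ← abs_mul] at h3
  have a3 := abs_le.1 h3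
  rw [trial, abs_le]
  constructor <;> linarith

omit he1 hd hd1 in
lemma integrable_mul_of_abs_le {f h : ℝ → ℝ} {A B : ℝ} (hf : Continuous f) (hh : Continuous h)
    (hfA : ∀ x, |f x| ≤ A * Real.exp (-((e * x) ^ 2 / 2)))
    (hhB : ∀ x, |h x| ≤ B * Real.exp (-((e * x) ^ 2 / 2))) : Integrable fun x => f x * h x := by
  refine integrable_of_abs_le_gau (C := A * B) he (hf.mul hh) fun x => ?_
  rw [abs_mul, gau_eq_sq]
  calc _ ≤ (A * Real.exp (-((e * x) ^ 2 / 2))) * (B * Real.exp (-((e * x) ^ 2 / 2))) :=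
        mul_le_mul (hfA x) (hhB x) (abs_nonneg _) ((abs_nonneg _).trans (hfA x))
    _ = _ := by ring

omit he1 hd hd1 in
lemma integral_sq_le_of_abs_le {f : ℝ → ℝ} {A : ℝ} (hf : Continuous f)
    (hfA : ∀ x, |f x| ≤ A * Real.exp (-((e * x) ^ 2 / 2))) :
    ∫ x, f x ^ 2 ≤ A ^ 2 * (Real.sqrt Real.pi / e) := by
  rw [← integral_gau he, ← integral_const_mul]
  refine integral_mono ?_ ((integrable_gau he).const_mul _) fun x => ?_
  · simpa only [sq] using integrable_mul_of_abs_le he hf hf hfA hfA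
  · simp only
    rw [gau_eq_sq, ← sq_abs, ← mul_pow]
    exact pow_le_pow_left₀ (abs_nonneg _) (hfA x) 2

lemma integral_energy_trial :
    ∫ x, ((trialResidual e d x - trial e d x) ^ 2 + trial e d x ^ 2) =
      2 * (∫ x, trialDeriv e d x ^ 2) + ∫ x, trialResidual e d x ^ 2 := by
  have cu : Continuous (trial e d) :=
    continuous_iff_continuousAt.2 fun x => (hasDerivAt_trial e d x).continuousAt
  have cv := continuous_trialDeriv e d
  have cr := continuous_trialResidual e d
  have bu := abs_trial_le (e := e) hd hd1
  have bv := abs_trialDeriv_le' he he1 hd hd1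
  have br := abs_trialResidual_le he he1 hd
  have iuu := integrable_mul_of_abs_le he cu cu bu bu
  have iuv := integrable_mul_of_abs_le he cu cv bu bv
  have ivv := integrable_mul_of_abs_le he cv cv bv bv
  have iur := integrable_mul_of_abs_le he cu cr bu br
  have irr := integrable_mul_of_abs_le he cr cr br br
  have hder : ∀ x, HasDerivAt (fun x => trial e d x * trialDeriv e d x)
      (trialDeriv e d x * trialDeriv e d x + (trial e d x * trialResidual e d x
        - trial e d x * trial e d x)) x := fun x =>
    ((hasDerivAt_trial e d x).mul (hasDerivAt_trialDeriv e d x)).congr_deriv (by ring)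
  have i1 : Integrable fun x => trialDeriv e d x * trialDeriv e d x +
      (trial e d x * trialResidual e d x - trial e d x * trial e d x) := ivv.add (iur.sub iuu)
  have i2 : Integrable fun x => 2 * (trialDeriv e d x * trialDeriv e d x) +
      trialResidual e d x * trialResidual e d x := (ivv.const_mul 2).add irr
  have h0 := integral_eq_zero_of_hasDerivAt_of_integrable hder i1 iuv
  have h1 : ∀ x, (trialResidual e d x - trial e d x) ^ 2 + trial e d x ^ 2 =
      (2 * (trialDeriv e d x * trialDeriv e d x) + trialResidual e d x * trialResidual e d x) -
      2 * (trialDeriv e d x * trialDeriv e d x + (trial e d x * trialResidual e d x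
        - trial e d x * trial e d x)) := fun x => by ring
  simp only [h1]
  rw [integral_sub i2 (i1.const_mul 2),
    integral_add (ivv.const_mul 2) irr, integral_const_mul, integral_const_mul, h0]
  simp only [sq]
  ring

end

/-- `trial` as a Schwartz function. -/
noncomputable def trialSchwartz {e : ℝ} (he : 0 < e) (d : ℝ) : SchwartzMap ℝ ℝ :=
  gauTrigSchwartz he 1 (-1) 0 + gauTrigSchwartz he 2 0 (Polynomial.C (-(d / 2)))

lemma trialSchwartz_apply {e : ℝ} (he : 0 < e) (d x : ℝ) : trialSchwartz he d x = trial e d x := by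
  change gauTrig e 1 (-1) 0 x + gauTrig e 2 0 (Polynomial.C (-(d / 2))) x = _
  simp [gauTrig, trial]
  ring

lemma exists_modulation {c q : ℝ} (hc : 0 < c) (hq0 : 0 < q) (hq1 : q < 1) :
    ∃ e d : ℝ, 0 < e ∧ e ≤ 1 ∧ 0 < d ∧ d ≤ 1 ∧
      98 * (e + d) ^ 2 < c * e ^ q * (d * (1 / 24 - 16 * e) - 600 * (e + d) ^ 2) := by
  have t : ∀ r : ℝ, 0 < r → Filter.Tendsto (fun e : ℝ => e ^ r) (nhdsWithin 0 (Set.Ioi 0))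
      (nhds 0) := fun r hr => by
    have := (Real.continuousAt_rpow_const 0 r (Or.inr hr.le)).tendsto
    rw [Real.zero_rpow hr.ne'] at this
    exact this.mono_left nhdsWithin_le_nhds
  have hk : 0 < c / 80000 := by positivity
  have e1 := (t 1 one_pos).eventually (gt_mem_nhds (show (0 : ℝ) < 1 / 768 by norm_num))
  have e2 := (t q hq0).eventually (gt_mem_nhds (show 0 < 1 / 230400 / (c / 80000) by positivity))
  have e3 := (t (1 - q) (by linarith)).eventually (gt_mem_nhds hk)
  obtain ⟨e, h1, h2, h3, he⟩ := (e1.and (e2.and (e3.and self_mem_nhdsWithin))).exists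
  have he : 0 < e := he
  rw [Real.rpow_one] at h1
  rw [lt_div_iff₀ hk] at h2
  have hq : 0 < e ^ q := Real.rpow_pos_of_pos he q
  have h4 : e ≤ c / 80000 * e ^ q := by
    have : e = e ^ (1 - q) * e ^ q := by rw [← Real.rpow_add he]; simp
    calc e = e ^ (1 - q) * e ^ q := this
      _ ≤ _ := by gcongr
  obtain ⟨d, hd⟩ : ∃ d, d = c / 80000 * e ^ q := ⟨_, rfl⟩
  have hd0 : 0 < d := by rw [hd]; positivity
  have hcd : c * e ^ q = 80000 * d := by rw [hd]; ring
  rw [← hd] at h4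
  have hd1 : d < 1 / 230400 := by rw [hd]; linarith
  refine ⟨e, d, he, by linarith, hd0, by linarith, ?_⟩
  rw [hcd]
  have h5 : (e + d) ^ 2 ≤ 4 * d ^ 2 := by nlinarith
  have h6 : d / 96 ≤ d * (1 / 24 - 16 * e) - 600 * (e + d) ^ 2 := by nlinarith
  nlinarith [mul_le_mul_of_nonneg_left h6 hd0.le, mul_pos hd0 hd0]

lemma exists_schwartz_Ifun_lt (p lam : ℝ) (hp1 : 1 < p) (hp3 : p < 3) (hlam : 0 < lam) :
    ∃ u : SchwartzMap ℝ ℝ, (∫ x : ℝ, (deriv u x) ^ 2) = lam ∧ Ifun p u < lam := by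
  have hpi : 0 < Real.sqrt Real.pi := Real.sqrt_pos.2 Real.pi_pos
  obtain ⟨e, d, he, he1, hd, hd1, hmain⟩ := exists_modulation
    (c := (lam / (25 * Real.sqrt Real.pi)) ^ ((p - 1) / 2)) (q := (p - 1) / 2)
    (by positivity) (by linarith) (by linarith)
  rw [← Real.mul_rpow (by positivity) he.le] at hmain
  have hN := integral_power_trialDeriv_ge hp1 hp3 he he1 hd hd1
  have hR := integral_sq_le_of_abs_le he (continuous_trialResidual e d)
    (abs_trialResidual_le he he1 hd)
  have hM := integral_sq_le_of_abs_le he (continuous_trialDeriv e d)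
    (abs_trialDeriv_le' he he1 hd hd1)
  have hEn := integral_energy_trial he he1 hd hd1
  have hJ : 0 < Real.sqrt Real.pi / e := by positivity
  obtain ⟨J, hJdef⟩ : ∃ J, J = Real.sqrt Real.pi / e := ⟨_, rfl⟩
  have hbase : lam / (25 * Real.sqrt Real.pi) * e = lam / (25 * J) := by
    rw [hJdef]; field_simp
  rw [hbase] at hmain
  rw [← hJdef] at hN hR hM hJ
  obtain ⟨B, hB⟩ : ∃ B, B = d * (1 / 24 - 16 * e) - 600 * (e + d) ^ 2 := ⟨_, rfl⟩
  rw [← hB] at hN hmain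
  have hB0 : 0 < B := by
    by_contra! h
    have h1 : 0 ≤ (lam / (25 * J)) ^ ((p - 1) / 2) := by positivity
    have h2 : 0 < (e + d) ^ 2 := by positivity
    nlinarith [mul_nonneg h1 (neg_nonneg.2 h)]
  have hNpos : 0 < ∫ x, |trialDeriv e d x| ^ p * trialDeriv e d x :=
    lt_of_lt_of_le (by positivity) hN
  have hvv : Integrable fun x => trialDeriv e d x ^ 2 := by
    simpa only [sq] using integrable_mul_of_abs_le he (continuous_trialDeriv e d)
      (continuous_trialDeriv e d) (abs_trialDeriv_le' he he1 hd hd1)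
      (abs_trialDeriv_le' he he1 hd hd1)
  have hMpos : 0 < ∫ x, trialDeriv e d x ^ 2 := by
    refine lt_of_le_of_ne (integral_nonneg fun x => sq_nonneg _) fun h => ?_
    have h1 := (integral_eq_zero_iff_of_nonneg (fun x => sq_nonneg _) hvv).1 h.symm
    refine hNpos.ne' (integral_eq_zero_of_ae ?_)
    filter_upwards [h1] with x hx
    have : trialDeriv e d x = 0 := by simpa using hx
    simp [this]
  generalize hMdef : ∫ x, trialDeriv e d x ^ 2 = M at *
  generalize hNdef : ∫ x, |trialDeriv e d x| ^ p * trialDeriv e d x = N at *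
  generalize hRdef : ∫ x, trialResidual e d x ^ 2 = R at *
  obtain ⟨s, hs⟩ : ∃ s, s = Real.sqrt (lam / M) := ⟨_, rfl⟩
  have hs0 : 0 < s := by rw [hs]; positivity
  have hs2 : s ^ 2 = lam / M := by rw [hs, Real.sq_sqrt (by positivity)]
  have hsp : (lam / (25 * J)) ^ ((p - 1) / 2) ≤ s ^ (p - 1) := by
    have : s ^ (p - 1) = (s ^ 2) ^ ((p - 1) / 2) := by
      rw [← Real.rpow_natCast, ← Real.rpow_mul hs0.le]; congr 1; push_cast; ring
    rw [this, hs2]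
    apply Real.rpow_le_rpow (by positivity) _ (by linarith)
    exact div_le_div_of_nonneg_left hlam.le hMpos (by linarith)
  have hu : ⇑(s • trialSchwartz he d) = fun x => s * trial e d x := by
    funext x; simp [trialSchwartz_apply]
  have hdu : deriv (fun x => s * trial e d x) = fun x => s * trialDeriv e d x := by
    funext x; exact ((hasDerivAt_trial e d x).const_mul s).deriv
  have hddu : deriv (fun x => s * trialDeriv e d x) =
      fun x => s * (trialResidual e d x - trial e d x) := by
    funext x; exact ((hasDerivAt_trialDeriv e d x).const_mul s).deriv
  refine ⟨s • trialSchwartz he d, ?_, ?_⟩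
  · simp only [hu, hdu, mul_pow]
    rw [integral_const_mul, hMdef, hs2]
    field_simp
  · unfold Ifun
    simp only [hu, hdu, hddu, mul_pow, abs_mul, abs_of_pos hs0, ← mul_add]
    have h1 : ∀ x, (s * |trialDeriv e d x|) ^ p * (s * trialDeriv e d x) =
        (s ^ 2 * s ^ (p - 1)) * (|trialDeriv e d x| ^ p * trialDeriv e d x) := fun x => by
      rw [Real.mul_rpow hs0.le (abs_nonneg _), Real.rpow_sub_one hs0.ne']
      field_simp
    simp only [h1]
    rw [integral_const_mul, integral_const_mul, hEn, hNdef]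
    have h2 : J * B ≤ 1 / (p + 1) * N := by
      rw [one_div, ← div_eq_inv_mul, le_div_iff₀ (by linarith)]; linarith
    have h3 : R / 2 < s ^ (p - 1) * (1 / (p + 1) * N) :=
      calc R / 2 ≤ J * (98 * (e + d) ^ 2) := by linarith
        _ < J * ((lam / (25 * J)) ^ ((p - 1) / 2) * B) := by gcongr
        _ = (lam / (25 * J)) ^ ((p - 1) / 2) * (J * B) := by ring
        _ ≤ s ^ (p - 1) * (1 / (p + 1) * N) := by gcongr
    have h4 := mul_lt_mul_of_pos_left h3 (by positivity : 0 < s ^ 2)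
    have h5 : s ^ 2 * M = lam := by rw [hs2]; field_simp
    linarith

/-- For `1 < p < 3` and `λ > 0` there is a Schwartz function on the constraint set with
`I[u] < λ`; in particular the infimum `m_I(λ)` satisfies `m_I(λ) < λ`. -/
theorem mI_lt_lambda (p lam : ℝ) (hp1 : 1 < p) (hp3 : p < 3) (hlam : 0 < lam) :
    (∃ u : SchwartzMap ℝ ℝ, (∫ x : ℝ, (deriv u x) ^ 2) = lam ∧ Ifun p u < lam) ∧
    sInf {r : ℝ | ∃ u : SchwartzMap ℝ ℝ,
      (∫ x : ℝ, (deriv u x) ^ 2) = lam ∧ Ifun p u = r} < lam := by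
  have h := exists_schwartz_Ifun_lt p lam hp1 hp3 hlam
  refine ⟨h, ?_⟩
  obtain ⟨u, hu, hlt⟩ := h
  by_cases hb : BddBelow {r : ℝ | ∃ u : SchwartzMap ℝ ℝ,
      (∫ x : ℝ, (deriv u x) ^ 2) = lam ∧ Ifun p u = r}
  · exact (csInf_le hb ⟨u, hu, rfl⟩).trans_lt hlt
  · rwa [Real.sInf_of_not_bddBelow hb]
end

section
/- Let p > 1 and let χ : ℝ → ℝ be a nonnegative Schwartz function. Then there exists a constant C > 0 such that for every ε > 0, |∫_ℝ χ(εx)^{p+1} cos(x) |cos(x)|^{p} dx| ≤ C; that is, the integral ∫_ℝ χ(εx)^{p+1} cos(x)|cos(x)|^{p} dx remains bounded uniformly as ε → 0+. -/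
open MeasureTheory

/-- A function with `g (x + c) = -g x` has bounded primitives. -/
theorem exists_bound_intervalIntegral_of_antiperiodic {g : ℝ → ℝ} (hg : Continuous g) {c : ℝ}
    (hc : 0 < c) (h : Function.Antiperiodic g c) :
    ∃ M, ∀ x : ℝ, |∫ t in (0 : ℝ)..x, g t| ≤ M := by
  have hi : ∀ a b, IntervalIntegrable g volume a b := fun a b => hg.intervalIntegrable a b
  have hs : ∀ x : ℝ, ∫ t in (0 : ℝ)..(x + c), g t =
      (∫ t in (0 : ℝ)..c, g t) - ∫ t in (0 : ℝ)..x, g t := by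
    intro x
    have h1 := intervalIntegral.integral_comp_add_right (a := 0) (b := x) g c
    simp only [h _, intervalIntegral.integral_neg, zero_add] at h1
    rw [← intervalIntegral.integral_add_adjacent_intervals (hi 0 c) (hi c (x + c)), ← h1]
    ring
  have hper : Function.Periodic (fun x : ℝ => ∫ t in (0 : ℝ)..x, g t) (c + c) := by
    intro x
    simp only [← add_assoc, hs]
    ring
  have hcont : Continuous (fun x : ℝ => ∫ t in (0 : ℝ)..x, g t) :=
    intervalIntegral.continuous_primitive hi 0
  obtain ⟨M, hM⟩ := (hper.isBounded_of_continuous (by positivity) hcont).exists_norm_le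
  exact ⟨M, fun x => hM _ ⟨x, rfl⟩⟩

/-- The integral of a dilated function against an oscillating one is controlled, uniformly in the
dilation, by the primitive of the latter and the `L¹` norm of the derivative of the former. -/
theorem abs_integral_comp_mul_mul_le {f f' g G : ℝ → ℝ} {M N : ℝ}
    (hf : ∀ x, HasDerivAt f (f' x) x) (hfi : Integrable f) (hfi' : Integrable f')
    (hG : ∀ x, HasDerivAt G (g x) x) (hg : Continuous g) (hN : ∀ x, |g x| ≤ N)
    (hM : ∀ x, |G x| ≤ M) {ε : ℝ} (hε : 0 < ε) :
    |∫ x, f (ε * x) * g x| ≤ M * ∫ x, |f' x| := by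
  have hGc : Continuous G := continuous_iff_continuousAt.2 fun x => (hG x).continuousAt
  have h1 : Integrable fun x => f (ε * x) := hfi.comp_mul_left' hε.ne'
  have h2 : Integrable fun x => f' (ε * x) * ε := (hfi'.comp_mul_left' hε.ne').mul_const ε
  have hd : ∀ x, HasDerivAt (fun x => f (ε * x)) (f' (ε * x) * ε) x := fun x => by
    simpa [Function.comp_def] using (hf (ε * x)).comp x ((hasDerivAt_id x).const_mul ε)
  rw [integral_mul_deriv_eq_deriv_mul_of_integrable (fun x _ => hd x) (fun x _ => hG x)
    (h1.mul_bdd hg.aestronglyMeasurable (ae_of_all _ hN))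
    (h2.mul_bdd hGc.aestronglyMeasurable (ae_of_all _ hM))
    (h1.mul_bdd hGc.aestronglyMeasurable (ae_of_all _ hM)), abs_neg]
  calc |∫ x, f' (ε * x) * ε * G x| ≤ ∫ x, |f' (ε * x)| * (ε * M) := by
        refine norm_integral_le_of_norm_le (f := fun x => f' (ε * x) * ε * G x)
          ((hfi'.comp_mul_left' hε.ne').abs.mul_const _) (ae_of_all _ fun x => ?_)
        rw [Real.norm_eq_abs, abs_mul, abs_mul, abs_of_pos hε, mul_assoc]
        gcongr
        exact hM x
    _ = M * ∫ x, |f' x| := by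
        rw [integral_mul_const, Measure.integral_comp_mul_left (fun x => |f' x|) ε,
          abs_of_pos (inv_pos.2 hε), smul_eq_mul]
        field_simp

/-- The integral `∫ χ(εx)^{p+1} cos(x) |cos(x)|^p dx` stays bounded uniformly in `ε > 0`. -/
theorem K_term_bounded (p : ℝ) (hp : 1 < p) (χ : SchwartzMap ℝ ℝ)
    (hχ : ∀ x : ℝ, 0 ≤ χ x) :
    ∃ C > 0, ∀ ε > (0 : ℝ),
      |∫ x : ℝ, (χ (ε * x) : ℝ) ^ (p + 1) * Real.cos x * |Real.cos x| ^ p| ≤ C := by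
  have hp0 : 0 < p := by linarith
  have hg : Continuous fun x : ℝ => Real.cos x * |Real.cos x| ^ p :=
    Real.continuous_cos.mul (Real.continuous_cos.abs.rpow_const fun _ => Or.inr hp0.le)
  obtain ⟨M, hM⟩ := exists_bound_intervalIntegral_of_antiperiodic hg Real.pi_pos fun x => by
    simp [Real.cos_add_pi]
  have hN : ∀ x : ℝ, |Real.cos x * |Real.cos x| ^ p| ≤ 1 := fun x => by
    rw [abs_mul, abs_of_nonneg (Real.rpow_nonneg (abs_nonneg (Real.cos x)) p)]
    exact mul_le_one₀ (Real.abs_cos_le_one x) (by positivity)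
      (Real.rpow_le_one (abs_nonneg _) (Real.abs_cos_le_one x) hp0.le)
  obtain ⟨B, -, hB⟩ := χ.decay 0 0
  have hχB : ∀ x, χ x ≤ B := fun x => (le_abs_self _).trans (by simpa using hB x)
  have hcp : Continuous fun x => χ x ^ p := χ.continuous.rpow_const fun _ => Or.inr hp0.le
  have hbp : ∀ x, ‖χ x ^ p‖ ≤ B ^ p := fun x => by
    rw [Real.norm_of_nonneg (Real.rpow_nonneg (hχ x) p)]
    exact Real.rpow_le_rpow (hχ x) (hχB x) hp0.le
  have hf : ∀ x, HasDerivAt (fun x => χ x ^ (p + 1)) (deriv χ x * (p + 1) * χ x ^ p) x :=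
    fun x => by
      simpa using χ.differentiableAt.hasDerivAt.rpow_const (p := p + 1) (x := x)
        (Or.inr (by linarith))
  have hfi : Integrable fun x => χ x ^ (p + 1) := by
    refine (χ.integrable.mul_bdd hcp.aestronglyMeasurable (ae_of_all _ hbp)).congr
      (ae_of_all _ fun x => ?_)
    simp only [Real.rpow_add_one' (hχ x) (by linarith : p + 1 ≠ 0), mul_comm]
  have hfi' : Integrable fun x => deriv χ x * (p + 1) * χ x ^ p :=
    ((SchwartzMap.derivCLM ℝ ℝ χ).integrable.mul_const (p + 1)).mul_bdd
      hcp.aestronglyMeasurable (ae_of_all _ hbp)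
  refine ⟨max 1 (M * ∫ x, |deriv χ x * (p + 1) * χ x ^ p|), by positivity, fun ε hε => ?_⟩
  simp only [mul_assoc (_ ^ (p + 1))]
  exact (abs_integral_comp_mul_mul_le hf hfi hfi'
    (fun x => (hg.integral_hasStrictDerivAt 0 x).hasDerivAt) hg hN hM hε).trans (le_max_right _ _)
end

section
/- Let p > 1 and let χ : ℝ → ℝ be a nonnegative Schwartz function which is not identically zero. Then there exist constants c > 0 and C ≥ 0 such that for every ε ∈ (0,1], ∫_ℝ χ(εx)^{p+1} cos(2x) |cos(x)|^{p} dx ≥ c/ε − C. -/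
open MeasureTheory

/-- If `g` dominates `m + W'` with `W` bounded, then `∫ f (ε x) g x` is at least
`m ∫ f / ε` up to an error controlled by `∫ |f'|`. -/
lemma integral_comp_mul_lower_bound {f f' W w g : ℝ → ℝ} {m M B : ℝ}
    (hf : ∀ x, HasDerivAt f (f' x) x) (hf0 : ∀ x, 0 ≤ f x)
    (hfi : Integrable f) (hfi' : Integrable f')
    (hW : ∀ x, HasDerivAt W (w x) x) (hwc : Continuous w) (hgc : Continuous g)
    (hWM : ∀ x, |W x| ≤ M) (hwB : ∀ x, |w x| ≤ B) (hgB : ∀ x, |g x| ≤ B)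
    (hg : ∀ x, m + w x ≤ g x) {ε : ℝ} (hε : 0 < ε) :
    m * (∫ x, f x) / ε - M * ∫ x, |f' x| ≤ ∫ x, f (ε * x) * g x := by
  have hWc : Continuous W := continuous_iff_continuousAt.2 fun x => (hW x).continuousAt
  have hu : ∀ x, HasDerivAt (fun x => f (ε * x)) (f' (ε * x) * ε) x := fun x => by
    have := (hasDerivAt_id x).const_mul ε
    simp only [id, mul_one] at this
    exact (hf (ε * x)).comp x this
  have hi : Integrable fun x => f (ε * x) := hfi.comp_mul_left' hε.ne'
  have hi' : Integrable fun x => f' (ε * x) * ε := (hfi'.comp_mul_left' hε.ne').mul_const ε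
  have hfw : Integrable fun x => f (ε * x) * w x :=
    hi.mul_bdd hwc.aestronglyMeasurable (.of_forall hwB)
  have hfg : Integrable fun x => f (ε * x) * g x :=
    hi.mul_bdd hgc.aestronglyMeasurable (.of_forall hgB)
  have hfW : Integrable fun x => f (ε * x) * W x :=
    hi.mul_bdd hWc.aestronglyMeasurable (.of_forall hWM)
  have hfW' : Integrable fun x => f' (ε * x) * ε * W x :=
    hi'.mul_bdd hWc.aestronglyMeasurable (.of_forall hWM)
  have hparts := integral_mul_deriv_eq_deriv_mul_of_integrable (fun x _ => hu x)
    (fun x _ => hW x) hfw hfW' hfW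
  have hscale : ∀ h : ℝ → ℝ, ∫ x, h (ε * x) = (∫ x, h x) / ε := fun h => by
    rw [Measure.integral_comp_mul_left, abs_of_pos (inv_pos.2 hε), smul_eq_mul]
    ring
  have hmain : ∫ x, (m * f (ε * x) + f (ε * x) * w x) ≤ ∫ x, f (ε * x) * g x :=
    integral_mono ((hi.const_mul m).add hfw) hfg fun x => by
      have := mul_le_mul_of_nonneg_left (hg x) (hf0 (ε * x))
      dsimp only
      linarith
  rw [integral_add (hi.const_mul m) hfw, integral_const_mul, hscale, hparts] at hmain
  have herr : ∫ x, f' (ε * x) * ε * W x ≤ ∫ x, M * ε * |f' (ε * x)| :=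
    integral_mono hfW' ((hfi'.comp_mul_left' hε.ne').abs.const_mul _) fun x => by
      calc f' (ε * x) * ε * W x ≤ |f' (ε * x) * ε * W x| := le_abs_self _
        _ = |f' (ε * x)| * ε * |W x| := by rw [abs_mul, abs_mul, abs_of_pos hε]
        _ ≤ |f' (ε * x)| * ε * M := by gcongr; exact hWM x
        _ = M * ε * |f' (ε * x)| := by ring
  rw [integral_const_mul, hscale fun x => |f' x|] at herr
  have : M * ε * ((∫ x, |f' x|) / ε) = M * ∫ x, |f' x| := by field_simp
  rw [mul_div_assoc]
  linarith

/-- The tangent line of `u ↦ u ^ p` at `1 / 4` gives a lower bound. -/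
lemma tangent_le_rpow {p u : ℝ} (hp : 1 ≤ p) (hu : 0 ≤ u) :
    (1 / 4 : ℝ) ^ p * (1 - p + 4 * p * u) ≤ u ^ p := by
  have h := one_add_mul_self_le_rpow_one_add (s := 4 * u - 1) (by linarith) hp
  rw [add_sub_cancel, Real.mul_rpow (by norm_num) hu] at h
  have h4 : (1 / 4 : ℝ) ^ p * 4 ^ p = 1 := by
    rw [← Real.mul_rpow (by norm_num) (by norm_num)]
    norm_num
  calc (1 / 4 : ℝ) ^ p * (1 - p + 4 * p * u) ≤ (1 / 4 : ℝ) ^ p * (4 ^ p * u ^ p) := by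
        gcongr
        linarith
    _ = u ^ p := by rw [← mul_assoc, h4, one_mul]

lemma hasDerivAt_sin_mul_cos_mul_abs_cos_rpow {p : ℝ} (hp : 1 < p) (x : ℝ) :
    HasDerivAt (fun x => Real.sin x * Real.cos x * |Real.cos x| ^ p)
      (Real.cos (2 * x) * |Real.cos x| ^ p - p * Real.sin x ^ 2 * |Real.cos x| ^ p) x := by
  have h := ((Real.hasDerivAt_sin x).mul (Real.hasDerivAt_cos x)).mul
    ((hasDerivAt_abs_rpow (Real.cos x) hp).comp x (Real.hasDerivAt_cos x))
  refine h.congr_deriv ?_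
  have hc : |Real.cos x| ^ (p - 2) * Real.cos x ^ 2 = |Real.cos x| ^ p := by
    rcases eq_or_ne (Real.cos x) 0 with h0 | h0
    · simp [h0, Real.zero_rpow (by linarith : p ≠ 0)]
    · rw [← sq_abs, ← Real.rpow_natCast, ← Real.rpow_add (abs_pos.2 h0)]
      norm_num
  simp only [Pi.mul_apply, Function.comp_apply]
  rw [Real.cos_two_mul', ← hc]
  ring

lemma hasDerivAt_sin_two_four (a b x : ℝ) :
    HasDerivAt (fun x => a * Real.sin (2 * x) + b * Real.sin (4 * x))
      (2 * a * Real.cos (2 * x) + 4 * b * Real.cos (4 * x)) x := by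
  have h (k : ℝ) : HasDerivAt (fun x => Real.sin (k * x)) (Real.cos (k * x) * k) x := by
    simpa using ((hasDerivAt_id x).const_mul k).sin
  exact (((h 2).const_mul a).add ((h 4).const_mul b)).congr_deriv (by ring)

lemma abs_cos_rpow_le_one {p : ℝ} (hp : 0 ≤ p) (x : ℝ) : |Real.cos x| ^ p ≤ 1 :=
  Real.rpow_le_one (abs_nonneg _) (Real.abs_cos_le_one x) hp

lemma sin_sq_mul_abs_cos_rpow_lower_bound {p : ℝ} (hp : 1 ≤ p) (x : ℝ) :
    (1 / 4 : ℝ) ^ p * (1 / 2 - (1 - p) / 2 * Real.cos (2 * x) - p / 2 * Real.cos (4 * x)) ≤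
      Real.sin x ^ 2 * |Real.cos x| ^ p := by
  have h1 : (Real.cos x ^ 2) ^ p ≤ |Real.cos x| ^ p := by
    refine Real.rpow_le_rpow (sq_nonneg _) ?_ (by linarith)
    rw [← sq_abs]
    nlinarith [abs_nonneg (Real.cos x), Real.abs_cos_le_one x]
  have h2 := (tangent_le_rpow hp (sq_nonneg (Real.cos x))).trans h1
  refine le_trans (le_of_eq ?_) (mul_le_mul_of_nonneg_left h2 (sq_nonneg (Real.sin x)))
  rw [show 4 * x = 2 * (2 * x) by ring, Real.cos_two_mul (2 * x), Real.cos_two_mul x,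
    Real.sin_sq]
  ring

/-- Lower bound `c/ε - C` for the integral `∫ χ(εx)^{p+1} cos(2x) |cos(x)|^p dx`. -/
theorem Q_term_lower_bound (p : ℝ) (hp : 1 < p) (χ : SchwartzMap ℝ ℝ)
    (hχ : ∀ x : ℝ, 0 ≤ χ x) (hne : ∃ x : ℝ, χ x ≠ 0) :
    ∃ c > (0 : ℝ), ∃ C ≥ (0 : ℝ), ∀ ε ∈ Set.Ioc (0 : ℝ) 1,
      c / ε - C ≤ ∫ x : ℝ, (χ (ε * x) : ℝ) ^ (p + 1) * Real.cos (2 * x)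
        * |Real.cos x| ^ p := by
  have hp0 : 0 ≤ p := by linarith
  have hcont : Continuous χ := χ.continuous
  obtain ⟨A, hA⟩ : ∃ A, ∀ x, |χ x| ≤ A :=
    ⟨_, fun x => SchwartzMap.norm_le_seminorm ℝ χ x⟩
  have hpow : ∀ x, ‖χ x ^ p‖ ≤ A ^ p := fun x => by
    rw [Real.norm_of_nonneg (Real.rpow_nonneg (hχ x) p)]
    exact Real.rpow_le_rpow (hχ x) ((le_abs_self _).trans (hA x)) hp0
  have hpowm : AEStronglyMeasurable (fun x => χ x ^ p) volume :=
    (hcont.rpow_const fun _ => Or.inr hp0).aestronglyMeasurable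
  have hder : ∀ x, HasDerivAt (fun x => χ x ^ (p + 1)) (deriv χ x * (p + 1) * χ x ^ p) x :=
    fun x => by
      simpa using (χ.differentiableAt (x := x)).hasDerivAt.rpow_const
        (p := p + 1) (Or.inr (by linarith))
  have hfc : Continuous fun x => χ x ^ (p + 1) :=
    hcont.rpow_const fun _ => Or.inr (by linarith)
  have hf0 : ∀ x, 0 ≤ χ x ^ (p + 1) := fun x => Real.rpow_nonneg (hχ x) _
  have hfi : Integrable fun x => χ x ^ (p + 1) := by
    refine (χ.integrable.mul_bdd hpowm (.of_forall hpow)).congr (.of_forall fun x => ?_)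
    dsimp only
    rw [Real.rpow_add_one' (hχ x) (by linarith), mul_comm]
  have hfi' : Integrable fun x => deriv χ x * (p + 1) * χ x ^ p :=
    (((SchwartzMap.derivCLM ℝ ℝ χ).integrable (μ := volume)).mul_const (p + 1)).mul_bdd
      hpowm (.of_forall hpow)
  have hpos : 0 < ∫ x, χ x ^ (p + 1) := by
    obtain ⟨x, hx⟩ := hne
    exact integral_pos_of_integrable_nonneg_nonzero (x := x) hfc hfi hf0
      (Real.rpow_pos_of_pos ((hχ x).lt_of_ne' hx) _).ne'
  set K : ℝ := (1 / 4 : ℝ) ^ p with hK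
  have hK0 : 0 < K := by positivity
  set a : ℝ := -(p * K * (1 - p) / 4) with ha
  set b : ℝ := -(p * K * p / 8) with hb
  set M : ℝ := 1 + (|a| + |b|)
  set B : ℝ := 1 + p + (|2 * a| + |4 * b|)
  have habs : ∀ x, |(|Real.cos x| ^ p)| ≤ 1 := fun x => by
    rw [abs_of_nonneg (by positivity)]
    exact abs_cos_rpow_le_one hp0 x
  have hmul : ∀ r s : ℝ, |s| ≤ 1 → |r * s| ≤ |r| := fun r s hs => by
    rw [abs_mul]
    exact mul_le_of_le_one_right (abs_nonneg r) hs
  have hgB : ∀ x, |Real.cos (2 * x) * |Real.cos x| ^ p| ≤ 1 := fun x =>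
    (hmul _ _ (habs x)).trans (Real.abs_cos_le_one _)
  have habsc : Continuous fun x => |Real.cos x| ^ p :=
    Real.continuous_cos.abs.rpow_const fun _ => Or.inr hp0
  refine ⟨p * K / 2 * ∫ x, χ x ^ (p + 1), by positivity,
    M * ∫ x, |deriv χ x * (p + 1) * χ x ^ p|,
    mul_nonneg (by positivity) (integral_nonneg fun x => abs_nonneg _), fun ε hε => ?_⟩
  have key := integral_comp_mul_lower_bound (m := p * K / 2) (M := M) (B := B)
    (g := fun x => Real.cos (2 * x) * |Real.cos x| ^ p) hder hf0 hfi hfi'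
    (fun x => (hasDerivAt_sin_mul_cos_mul_abs_cos_rpow hp x).add (hasDerivAt_sin_two_four a b x))
    (by fun_prop) (by fun_prop) ?_ ?_ ?_ ?_ hε.1
  · simpa only [mul_assoc] using key
  · intro x
    refine (abs_add_le _ _).trans (add_le_add ?_ ((abs_add_le _ _).trans (add_le_add ?_ ?_)))
    · exact (hmul _ _ (habs x)).trans
        ((hmul _ _ (Real.abs_cos_le_one x)).trans (Real.abs_sin_le_one x))
    · exact hmul _ _ (Real.abs_sin_le_one _)
    · exact hmul _ _ (Real.abs_sin_le_one _)
  · intro x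
    refine (abs_add_le _ _).trans (add_le_add ((abs_sub _ _).trans (add_le_add (hgB x) ?_))
      ((abs_add_le _ _).trans (add_le_add ?_ ?_)))
    · refine (hmul _ _ (habs x)).trans ((hmul _ _ ?_).trans_eq (abs_of_nonneg hp0))
      rw [abs_of_nonneg (sq_nonneg _)]
      exact Real.sin_sq_le_one x
    · exact hmul _ _ (Real.abs_cos_le_one _)
    · exact hmul _ _ (Real.abs_cos_le_one _)
  · intro x
    refine (hgB x).trans ?_
    have : 0 ≤ |2 * a| + |4 * b| := by positivity
    linarith
  · intro x
    have h := mul_le_mul_of_nonneg_left (sin_sq_mul_abs_cos_rpow_lower_bound hp.le x) hp0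
    rw [← hK] at h
    rw [ha, hb]
    linarith
end
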